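/- Let d ≥ 3 and let F be a nonempty face (convex extreme subset) of the Birkhoff polytope B_{2d−2} with Module.finrank ℝ ↥(vectorSpan ℝ F) = d. Suppose that for every m < 2d − 2, no face of B_m is combinatorially isomorphic to F (i.e. F has Birkhoff dimension 2d − 2). Then at least one of the following holds: (a) F is combinatorially isomorphic to the pyramid over the (d−1)-cube; (b) there exist a ≥ 1 and b with a + b + 1 = d such that F is combinatorially isomorphic to (Set.Icc (0 : Fin a → ℝ) 1) ×ˢ (pyramid over the b-cube); (c) d ≥ 4 and F is combinatorially isomorphic to (stdSimplex ℝ (Fin 3)) ×ˢ (stdSimplex ℝ (Fin 3)) ×ˢ (Set.Icc (0 : Fin (d−4) → ℝ) 1). -/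

import Mathlib

/-- The permutation matrix of `σ`: entry 1 at `(i, σ i)` and 0 elsewhere. -/
def permMat {n : ℕ} (σ : Equiv.Perm (Fin n)) : Matrix (Fin n) (Fin n) ℝ :=
  fun i j => if σ i = j then 1 else 0

/-- `σ` is a (perfect) matching of the bipartite graph of `R`. -/
def IsMatching {n : ℕ} (R : Fin n → Fin n → Prop) (σ : Equiv.Perm (Fin n)) : Prop :=
  ∀ i, R i (σ i)

/-- `R` is elementary (a face graph): every edge lies in some matching. -/
def IsElementary {n : ℕ} (R : Fin n → Fin n → Prop) : Prop :=
  ∀ i j, R i j → ∃ σ : Equiv.Perm (Fin n), IsMatching R σ ∧ σ i = j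

/-- The face of the Birkhoff polytope corresponding to `R`. -/
def face {n : ℕ} (R : Fin n → Fin n → Prop) : Set (Matrix (Fin n) (Fin n) ℝ) :=
  convexHull ℝ {M | ∃ σ : Equiv.Perm (Fin n), IsMatching R σ ∧ M = permMat σ}

/-- The bipartite simple graph `G_R` on `Fin n ⊕ Fin n`, where `Sum.inl i` and
`Sum.inr j` are adjacent iff `R i j`. -/
def graphOf {n : ℕ} (R : Fin n → Fin n → Prop) : SimpleGraph (Fin n ⊕ Fin n) :=
  SimpleGraph.fromRel (fun a b => ∃ i j, a = Sum.inl i ∧ b = Sum.inr j ∧ R i j)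

/-- The degree of the upper node `i`. -/
def upDeg {n : ℕ} (R : Fin n → Fin n → Prop) [∀ i j, Decidable (R i j)] (i : Fin n) : ℕ :=
  Fintype.card {j // R i j}

/-- The degree of the lower node `j`. -/
def loDeg {n : ℕ} (R : Fin n → Fin n → Prop) [∀ i j, Decidable (R i j)] (j : Fin n) : ℕ :=
  Fintype.card {i // R i j}

/-- The number of edges of the bipartite graph of `R`. -/
def edgeCount {n : ℕ} (R : Fin n → Fin n → Prop) [∀ i j, Decidable (R i j)] : ℕ :=
  Fintype.card {p : Fin n × Fin n // R p.1 p.2}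

/-- An upper node `v` of degree 2 with neighbors `w₁ ≠ w₂` is reducible if no `u ≠ v`
is adjacent to both `w₁` and `w₂`. -/
def UpperReducible {n : ℕ} (R : Fin n → Fin n → Prop) (v : Fin n) : Prop :=
  ∃ w₁ w₂ : Fin n, w₁ ≠ w₂ ∧ R v w₁ ∧ R v w₂ ∧ (∀ j, R v j → j = w₁ ∨ j = w₂) ∧
    ¬ ∃ u, u ≠ v ∧ R u w₁ ∧ R u w₂

/-- Reducibility of lower nodes, defined symmetrically. -/
def LowerReducible {n : ℕ} (R : Fin n → Fin n → Prop) (v : Fin n) : Prop :=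
  UpperReducible (fun i j => R j i) v

/-- `R` is irreducible if none of its nodes is reducible. -/
def IrreducibleRel {n : ℕ} (R : Fin n → Fin n → Prop) : Prop :=
  (∀ v, ¬ UpperReducible R v) ∧ (∀ v, ¬ LowerReducible R v)

/-- The face poset of a set `P`: the collection of its faces (convex extreme subsets),
ordered by inclusion. -/
def facesOf {E : Type*} [AddCommGroup E] [Module ℝ E] (P : Set E) : Set (Set E) :=
  {F | Convex ℝ F ∧ IsExtreme ℝ P F}

/-- The pyramid over the `d`-cube, in the space `(Fin d → ℝ) × ℝ`. -/
def cubePyramid (d : ℕ) : Set ((Fin d → ℝ) × ℝ) :=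
  convexHull ℝ (((Set.Icc (0 : Fin d → ℝ) 1) ×ˢ ({0} : Set ℝ)) ∪
    {((0 : Fin d → ℝ), (1 : ℝ))})

section BirkhoffFaces

open Classical Set

section AffinelyEquivalent

variable {E E' E'' D D' : Type*} [AddCommGroup E] [AddCommGroup E'] [AddCommGroup E'']
  [AddCommGroup D] [AddCommGroup D'] [Module ℝ E] [Module ℝ E'] [Module ℝ E''] [Module ℝ D']
  [Module ℝ D]

/-- `f` preserves convex combinations of points of `P`. -/
def PreservesCombosOn (f : E → E') (P : Set E) : Prop :=
  ∀ x ∈ P, ∀ y ∈ P, ∀ a b : ℝ, 0 ≤ a → 0 ≤ b → a + b = 1 → f (a • x + b • y) = a • f x + b • f y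

/-- Two convex sets are affinely equivalent if there is a bijection between them that preserves
convex combinations. -/
def AffinelyEquivalent (P : Set E) (Q : Set E') : Prop :=
  Convex ℝ P ∧ ∃ f : E → E', PreservesCombosOn f P ∧ BijOn f P Q

lemma PreservesCombosOn.mono {f : E → E'} {P Q : Set E} (hf : PreservesCombosOn f Q)
    (h : P ⊆ Q) : PreservesCombosOn f P :=
  fun x hx y hy => hf x (h hx) y (h hy)

lemma PreservesCombosOn.convex_image {f : E → E'} {P : Set E} (hP : Convex ℝ P)
    (hf : PreservesCombosOn f P) : Convex ℝ (f '' P) := by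
  rintro _ ⟨x, hx, rfl⟩ _ ⟨y, hy, rfl⟩ a b ha hb hab
  exact ⟨a • x + b • y, hP hx hy ha hb hab, hf x hx y hy a b ha hb hab⟩

lemma PreservesCombosOn.invFunOn {f : E → E'} {P : Set E} {Q : Set E'} (hP : Convex ℝ P)
    (hf : PreservesCombosOn f P) (hb : BijOn f P Q) [Nonempty E] :
    PreservesCombosOn (Function.invFunOn f P) Q := by
  have hinv := hb.invOn_invFunOn
  have hm := hb.surjOn.mapsTo_invFunOn
  intro x hx y hy a b ha hb' hab
  conv_lhs => rw [← hinv.2 hx, ← hinv.2 hy, ← hf _ (hm hx) _ (hm hy) a b ha hb' hab]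
  exact hinv.1 (hP (hm hx) (hm hy) ha hb' hab)

namespace AffinelyEquivalent

lemma of_invOn {P : Set E} {Q : Set E'} (hP : Convex ℝ P) (f : E → E') (g : E' → E)
    (hf : PreservesCombosOn f P) (h₁ : MapsTo f P Q) (h₂ : MapsTo g Q P)
    (h₃ : ∀ x ∈ P, g (f x) = x) (h₄ : ∀ y ∈ Q, f (g y) = y) : AffinelyEquivalent P Q :=
  ⟨hP, f, hf, InvOn.bijOn ⟨h₃, h₄⟩ h₁ h₂⟩

lemma refl {P : Set E} (hP : Convex ℝ P) : AffinelyEquivalent P P :=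
  ⟨hP, id, fun _ _ _ _ _ _ _ _ _ => rfl, bijOn_id P⟩

lemma convex_right {P : Set E} {Q : Set E'} (h : AffinelyEquivalent P Q) : Convex ℝ Q := by
  obtain ⟨hP, f, hf, hb⟩ := h
  rw [← hb.image_eq]
  exact hf.convex_image hP

lemma symm {P : Set E} {Q : Set E'} (h : AffinelyEquivalent P Q) : AffinelyEquivalent Q P := by
  refine ⟨h.convex_right, ?_⟩
  obtain ⟨hP, f, hf, hb⟩ := h
  exact ⟨_, hf.invFunOn hP hb, InvOn.bijOn hb.invOn_invFunOn.symm
    hb.surjOn.mapsTo_invFunOn hb.mapsTo⟩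

lemma trans {P : Set E} {Q : Set E'} {S : Set E''} (h : AffinelyEquivalent P Q)
    (h' : AffinelyEquivalent Q S) : AffinelyEquivalent P S := by
  obtain ⟨hP, f, hf, hb⟩ := h
  obtain ⟨hQ, g, hg, hb'⟩ := h'
  refine ⟨hP, g ∘ f, fun x hx y hy a b ha hb'' hab => ?_, hb'.comp hb⟩
  simp only [Function.comp]
  rw [hf x hx y hy a b ha hb'' hab,
    hg _ (hb.mapsTo hx) _ (hb.mapsTo hy) a b ha hb'' hab]

lemma prod {P : Set E} {Q : Set E'} {S : Set D} {T : Set D'} (h : AffinelyEquivalent P Q)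
    (h' : AffinelyEquivalent S T) : AffinelyEquivalent (P ×ˢ S) (Q ×ˢ T) := by
  obtain ⟨hP, f, hf, hb⟩ := h
  obtain ⟨hQ, g, hg, hb'⟩ := h'
  refine ⟨hP.prod hQ, Prod.map f g, ?_, hb.prodMap hb'⟩
  rintro ⟨x, x'⟩ ⟨hx, hx'⟩ ⟨y, y'⟩ ⟨hy, hy'⟩ a b ha hb'' hab
  exact Prod.ext (hf x hx y hy a b ha hb'' hab) (hg x' hx' y' hy' a b ha hb'' hab)

lemma prodComm {P : Set E} {Q : Set E'} (hP : Convex ℝ P) (hQ : Convex ℝ Q) :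
    AffinelyEquivalent (P ×ˢ Q) (Q ×ˢ P) :=
  of_invOn (hP.prod hQ) Prod.swap Prod.swap (fun _ _ _ _ _ _ _ _ _ => rfl)
    (fun _ h => ⟨h.2, h.1⟩) (fun _ h => ⟨h.2, h.1⟩) (fun _ _ => rfl) (fun _ _ => rfl)

lemma prod_unique {P : Set E} (hP : Convex ℝ P) (y : E') :
    AffinelyEquivalent (P ×ˢ {y}) P := by
  refine of_invOn (hP.prod (convex_singleton y)) Prod.fst (fun x => (x, y))
    (fun _ _ _ _ _ _ _ _ _ => rfl) (fun _ h => h.1) (fun _ h => ⟨h, rfl⟩) ?_ (fun _ _ => rfl)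
  rintro ⟨x, y'⟩ ⟨_, h⟩
  exact Prod.ext rfl (mem_singleton_iff.1 h).symm

lemma pi {ι : Type*} {V W : ι → Type*} [∀ i, AddCommGroup (V i)] [∀ i, Module ℝ (V i)]
    [∀ i, AddCommGroup (W i)] [∀ i, Module ℝ (W i)] {P : ∀ i, Set (V i)} {Q : ∀ i, Set (W i)}
    (h : ∀ i, AffinelyEquivalent (P i) (Q i)) :
    AffinelyEquivalent (univ.pi P) (univ.pi Q) := by
  choose hP f hf hb using h
  refine of_invOn (convex_pi fun i _ => hP i) (fun x i => f i (x i))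
    (fun y i => Function.invFunOn (f i) (P i) (y i)) ?_ ?_ ?_ ?_ ?_
  · intro x hx y hy a b ha hb' hab
    funext i
    exact hf i _ (hx i trivial) _ (hy i trivial) a b ha hb' hab
  · exact fun x hx i _ => (hb i).mapsTo (hx i trivial)
  · exact fun x hx i _ => (hb i).surjOn.mapsTo_invFunOn (hx i trivial)
  · exact fun x hx => funext fun i => (hb i).invOn_invFunOn.1 (hx i trivial)
  · exact fun x hx => funext fun i => (hb i).invOn_invFunOn.2 (hx i trivial)

/-- Split off one factor of a product. -/
lemma pi_split {ι : Type*} {V : ι → Type*} [∀ i, AddCommGroup (V i)] [∀ i, Module ℝ (V i)]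
    {P : ∀ i, Set (V i)} (hP : ∀ i, Convex ℝ (P i)) (k : ι) :
    AffinelyEquivalent (univ.pi P) (P k ×ˢ univ.pi fun i : {i // i ≠ k} => P i) := by
  refine of_invOn (convex_pi fun i _ => hP i) (fun x => (x k, fun i => x i))
    (fun y i => if h : i = k then h ▸ y.1 else y.2 ⟨i, h⟩)
    (fun _ _ _ _ _ _ _ _ _ => rfl) (fun x hx => ⟨hx k trivial, fun i _ => hx i trivial⟩) ?_ ?_ ?_
  · rintro ⟨x, y⟩ ⟨hx, hy⟩ i -
    by_cases h : i = k
    · subst h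
      simpa using hx
    · simpa [h] using hy ⟨i, h⟩ trivial
  · intro x _
    funext i
    by_cases h : i = k
    · subst h
      simp
    · simp [h]
  · rintro ⟨x, y⟩ _
    refine Prod.ext (by simp) (funext fun i => ?_)
    simp [i.2]

/-- A product of segments is a cube. -/
lemma pi_segment {ι : Type*} [Fintype ι] {V : ι → Type*} [∀ i, AddCommGroup (V i)]
    [∀ i, Module ℝ (V i)] {P : ∀ i, Set (V i)}
    (h : ∀ i, AffinelyEquivalent (P i) (Icc (0 : ℝ) 1)) {k : ℕ} (hk : Fintype.card ι = k) :
    AffinelyEquivalent (univ.pi P) (Icc (0 : Fin k → ℝ) 1) := by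
  let e : ι ≃ Fin k := Fintype.equivFinOfCardEq hk
  refine (pi h).trans (of_invOn (convex_pi fun i _ => convex_Icc 0 1) (fun x i => x (e.symm i))
    (fun y i => y (e i)) (fun _ _ _ _ _ _ _ _ _ => rfl) ?_ ?_ ?_ ?_)
  · exact fun x hx => ⟨fun i => (hx _ trivial).1, fun i => (hx _ trivial).2⟩
  · exact fun x hx i _ => ⟨hx.1 _, hx.2 _⟩
  · exact fun x _ => funext fun i => by simp
  · exact fun x _ => funext fun i => by simp

lemma image_mem_facesOf {P : Set E} {Q : Set E'} {f : E → E'} (hP : Convex ℝ P)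
    (hf : PreservesCombosOn f P) (hb : BijOn f P Q) {t : Set E} (ht : t ∈ facesOf P) :
    f '' t ∈ facesOf Q := by
  obtain ⟨hc, hsub, hext⟩ := ht
  refine ⟨(hf.mono hsub).convex_image hc, ?_, ?_⟩
  · rw [← hb.image_eq]
    exact image_mono hsub
  · rintro x₁ hx₁ x₂ hx₂ _ ⟨x, hx, rfl⟩ ⟨a, b, ha, hb', hab, h⟩
    obtain ⟨y₁, hy₁, rfl⟩ := hb.surjOn hx₁
    obtain ⟨y₂, hy₂, rfl⟩ := hb.surjOn hx₂
    rw [← hf _ hy₁ _ hy₂ a b ha.le hb'.le hab] at h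
    have := hb.injOn (hP hy₁ hy₂ ha.le hb'.le hab) (hsub hx) h
    exact ⟨y₁, hext hy₁ hy₂ hx ⟨a, b, ha, hb', hab, this⟩, rfl⟩

/-- Affinely equivalent convex sets have isomorphic face posets. -/
lemma facesOf_orderIso {P : Set E} {Q : Set E'} (h : AffinelyEquivalent P Q) :
    Nonempty (facesOf P ≃o facesOf Q) := by
  have hQ := h.convex_right
  obtain ⟨hP, f, hf, hb⟩ := h
  have hinv := hb.invOn_invFunOn
  have hb' : BijOn (Function.invFunOn f P) Q P :=
    InvOn.bijOn hinv.symm hb.surjOn.mapsTo_invFunOn hb.mapsTo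
  refine ⟨⟨⟨fun t => ⟨f '' t, image_mem_facesOf hP hf hb t.2⟩,
    fun t => ⟨_ '' t, image_mem_facesOf hQ (hf.invFunOn hP hb) hb' t.2⟩, ?_, ?_⟩, ?_⟩⟩
  · exact fun t => Subtype.ext ((hinv.1.mono t.2.2.1).image_image)
  · exact fun t => Subtype.ext ((hinv.2.mono t.2.2.1).image_image)
  · intro s t
    exact hb.injOn.image_subset_image_iff s.2.2.1 t.2.2.1

end AffinelyEquivalent

end AffinelyEquivalent

section Glue

variable {I J C : Type*} {p : I → C} {q : J → C}

/-- The block matrix with the given blocks on the fibres of a labelling. -/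
noncomputable def glueFibres (y : ∀ c, Matrix {i // p i = c} {j // q j = c} ℝ) : Matrix I J ℝ :=
  fun i j => if h : p i = q j then y (q j) ⟨i, h⟩ ⟨j, rfl⟩ else 0

lemma glueFibres_apply (y : ∀ c, Matrix {i // p i = c} {j // q j = c} ℝ) (c : C)
    (i : {i // p i = c}) (j : {j // q j = c}) : glueFibres y i j = y c i j := by
  obtain ⟨j, rfl⟩ := j
  exact dif_pos i.2

lemma glueFibres_of_ne (y : ∀ c, Matrix {i // p i = c} {j // q j = c} ℝ) {i : I} {j : J}
    (h : p i ≠ q j) : glueFibres y i j = 0 :=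
  dif_neg h

end Glue

section SuppFace

variable {I J I' J' : Type*} [Fintype I'] [Fintype J'] [Fintype I] [Fintype J]

/-- The face of the polytope of doubly stochastic matrices given by a support `R`. -/
def suppFace (R : I → J → Prop) : Set (Matrix I J ℝ) :=
  {x | (∀ i j, 0 ≤ x i j) ∧ (∀ i, ∑ j, x i j = 1) ∧ (∀ j, ∑ i, x i j = 1) ∧
    ∀ i j, ¬ R i j → x i j = 0}

lemma convex_suppFace (R : I → J → Prop) : Convex ℝ (suppFace R) := by
  rintro x ⟨h₁, h₂, h₃, h₄⟩ y ⟨k₁, k₂, k₃, k₄⟩ a b ha hb hab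
  refine ⟨fun i j => ?_, fun i => ?_, fun j => ?_, fun i j h => ?_⟩
  · exact add_nonneg (mul_nonneg ha (h₁ i j)) (mul_nonneg hb (k₁ i j))
  · simp [Finset.sum_add_distrib, ← Finset.mul_sum, h₂, k₂, hab]
  · simp [Finset.sum_add_distrib, ← Finset.mul_sum, h₃, k₃, hab]
  · simp [h₄ i j h, k₄ i j h]

lemma isExtreme_suppFace {n : ℕ} (R : Fin n → Fin n → Prop) :
    IsExtreme ℝ (doublyStochastic ℝ (Fin n) : Set (Matrix (Fin n) (Fin n) ℝ)) (suppFace R) := by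
  constructor
  · rintro x ⟨h₁, h₂, h₃, -⟩
    exact mem_doublyStochastic_iff_sum.2 ⟨h₁, h₂, h₃⟩
  · rintro x hx y hy _ ⟨-, -, -, h₄⟩ ⟨a, b, ha, hb, hab, rfl⟩
    obtain ⟨hx₁, hx₂, hx₃⟩ := mem_doublyStochastic_iff_sum.1 hx
    obtain ⟨hy₁, -, -⟩ := mem_doublyStochastic_iff_sum.1 hy
    refine ⟨hx₁, hx₂, hx₃, fun i j h => ?_⟩
    have h0 : a * x i j + b * y i j = 0 := h₄ i j h
    have := mul_nonneg hb.le (hy₁ i j)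
    have := mul_nonneg ha.le (hx₁ i j)
    have h1 : a * x i j = 0 := by linarith
    exact (mul_eq_zero.1 h1).resolve_left (ne_of_gt ha)

/-- A convex set of nonnegative matrices contains a matrix of largest support. -/
lemma exists_max_support {F : Set (Matrix I J ℝ)} (hne : F.Nonempty) (hc : Convex ℝ F)
    (h0 : ∀ x ∈ F, ∀ i j, 0 ≤ x i j) :
    ∃ x ∈ F, ∀ y ∈ F, ∀ i j, 0 < y i j → 0 < x i j := by
  have key : ∀ S : Finset (I × J), ∃ x ∈ F, ∀ p ∈ S, ∀ y ∈ F, 0 < y p.1 p.2 → 0 < x p.1 p.2 := by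
    intro S
    induction S using Finset.induction_on with
    | empty => exact ⟨hne.some, hne.some_mem, by simp⟩
    | insert p S _ ih =>
      obtain ⟨x, hx, h⟩ := ih
      by_cases hp : ∃ y ∈ F, 0 < y p.1 p.2
      · obtain ⟨y, hy, hpy⟩ := hp
        refine ⟨(1 / 2 : ℝ) • x + (1 / 2 : ℝ) • y,
          hc hx hy (by norm_num) (by norm_num) (by norm_num), fun q hq z hz hqz => ?_⟩
        have hx0 := h0 x hx q.1 q.2
        have hy0 := h0 y hy q.1 q.2
        simp only [Matrix.add_apply, Matrix.smul_apply, smul_eq_mul]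
        rcases Finset.mem_insert.1 hq with rfl | hq
        · linarith
        · linarith [h q hq z hz hqz]
      · push Not at hp
        refine ⟨x, hx, fun q hq z hz hqz => ?_⟩
        rcases Finset.mem_insert.1 hq with rfl | hq
        · exact absurd hqz (hp z hz).not_gt
        · exact h q hq z hz hqz
  obtain ⟨x, hx, h⟩ := key Finset.univ
  exact ⟨x, hx, fun y hy i j => h (i, j) (Finset.mem_univ _) y hy⟩

/-- A matrix supported where `x` is positive is dominated by a multiple of `x`. -/
lemma exists_mul_abs_le {x : Matrix I J ℝ} (h0 : ∀ i j, 0 ≤ x i j) (y : Matrix I J ℝ)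
    (h : ∀ i j, x i j = 0 → y i j = 0) :
    ∃ ε : ℝ, 0 < ε ∧ ∀ i j, ε * |y i j| ≤ x i j := by
  have key : ∀ S : Finset (I × J), ∃ ε : ℝ, 0 < ε ∧ ∀ p ∈ S, ε * |y p.1 p.2| ≤ x p.1 p.2 := by
    intro S
    induction S using Finset.induction_on with
    | empty => exact ⟨1, one_pos, by simp⟩
    | insert p S _ ih =>
      obtain ⟨ε, hε, hS⟩ := ih
      obtain ⟨δ, hδ, hp⟩ : ∃ δ : ℝ, 0 < δ ∧ δ * |y p.1 p.2| ≤ x p.1 p.2 := by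
        by_cases hy : y p.1 p.2 = 0
        · exact ⟨1, one_pos, by simp [hy, h0]⟩
        · have hx : 0 < x p.1 p.2 := lt_of_le_of_ne (h0 _ _) fun hx => hy (h _ _ hx.symm)
          refine ⟨x p.1 p.2 / |y p.1 p.2|, by positivity, ?_⟩
          rw [div_mul_cancel₀ _ (abs_ne_zero.2 hy)]
      refine ⟨min ε δ, lt_min hε hδ, fun q hq => ?_⟩
      rcases Finset.mem_insert.1 hq with rfl | hq
      · exact (mul_le_mul_of_nonneg_right (min_le_right _ _) (abs_nonneg _)).trans hp
      · exact (mul_le_mul_of_nonneg_right (min_le_left _ _) (abs_nonneg _)).trans (hS q hq)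
  obtain ⟨ε, hε, h⟩ := key Finset.univ
  exact ⟨ε, hε, fun i j => h (i, j) (Finset.mem_univ _)⟩

/-- Every nonempty face of the Birkhoff polytope is the face of some support. -/
lemma exists_eq_suppFace {n : ℕ} {F : Set (Matrix (Fin n) (Fin n) ℝ)} (hne : F.Nonempty)
    (hc : Convex ℝ F) (hext : IsExtreme ℝ
      (doublyStochastic ℝ (Fin n) : Set (Matrix (Fin n) (Fin n) ℝ)) F) :
    ∃ R : Fin n → Fin n → Prop, F = suppFace R ∧
      ∃ x ∈ suppFace R, ∀ i j, R i j → 0 < x i j := by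
  have hds : ∀ x ∈ F, _ := fun x hx => mem_doublyStochastic_iff_sum.1 (hext.1 hx)
  obtain ⟨x, hx, hmax⟩ := exists_max_support hne hc fun x hx => (hds x hx).1
  obtain ⟨hx₁, hx₂, hx₃⟩ := hds x hx
  have hsub : F ⊆ suppFace fun i j => 0 < x i j := by
    intro y hy
    obtain ⟨h₁, h₂, h₃⟩ := hds y hy
    refine ⟨h₁, h₂, h₃, fun i j h => ?_⟩
    by_contra hne
    exact h (hmax y hy i j (lt_of_le_of_ne (h₁ i j) (Ne.symm hne)))
  refine ⟨fun i j => 0 < x i j, hsub.antisymm ?_, x, hsub hx, fun i j h => h⟩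
  rintro y ⟨hy₁, hy₂, hy₃, hy₄⟩
  obtain ⟨ε, hε, hle⟩ := exists_mul_abs_le hx₁ (y - x) fun i j h => by
    simp [h, hy₄ i j (by simp [h])]
  have hz : x - ε • (y - x) ∈ doublyStochastic ℝ (Fin n) := by
    refine mem_doublyStochastic_iff_sum.2 ⟨fun i j => ?_, fun i => ?_, fun j => ?_⟩
    · have h1 := hle i j
      have h2 := le_abs_self (y i j - x i j)
      have h3 := mul_le_mul_of_nonneg_left h2 hε.le
      simp only [Matrix.sub_apply, Matrix.smul_apply, smul_eq_mul] at h1 ⊢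
      linarith
    · simp [Finset.sum_sub_distrib, ← Finset.mul_sum, hx₂, hy₂]
    · simp [Finset.sum_sub_distrib, ← Finset.mul_sum, hx₃, hy₃]
  refine hext.2 (mem_doublyStochastic_iff_sum.2 ⟨hy₁, hy₂, hy₃⟩) hz hx
    ⟨ε / (1 + ε), 1 / (1 + ε), by positivity, by positivity, by field_simp; ring, ?_⟩
  ext i j
  simp only [Matrix.add_apply, Matrix.smul_apply, Matrix.sub_apply, smul_eq_mul]
  field_simp
  ring

lemma suppFace_reindex (R : I → J → Prop) (e : I ≃ I') (e' : J ≃ J') (R' : I' → J' → Prop)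
    (h : ∀ i j, R i j ↔ R' (e i) (e' j)) :
    AffinelyEquivalent (suppFace R) (suppFace R') := by
  refine .of_invOn (convex_suppFace R) (fun x i j => x (e.symm i) (e'.symm j))
    (fun y i j => y (e i) (e' j)) (fun _ _ _ _ _ _ _ _ _ => rfl) ?_ ?_ ?_ ?_
  · rintro x ⟨h₁, h₂, h₃, h₄⟩
    refine ⟨fun i j => h₁ _ _, fun i => ?_, fun j => ?_, fun i j hR => h₄ _ _ ?_⟩
    · exact (e'.symm.sum_comp fun j => x (e.symm i) j).trans (h₂ _)
    · exact (e.symm.sum_comp fun i => x i (e'.symm j)).trans (h₃ _)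
    · simpa [h] using hR
  · rintro x ⟨h₁, h₂, h₃, h₄⟩
    refine ⟨fun i j => h₁ _ _, fun i => ?_, fun j => ?_, fun i j hR => h₄ _ _ ?_⟩
    · exact (e'.sum_comp fun j => x (e i) j).trans (h₂ _)
    · exact (e.sum_comp fun i => x i (e' j)).trans (h₃ _)
    · simpa [h] using hR
  · intro x _
    ext i j
    simp
  · intro x _
    ext i j
    simp

lemma transpose_mem_suppFace {R : I → J → Prop} {x : Matrix I J ℝ} (hx : x ∈ suppFace R) :
    x.transpose ∈ suppFace fun j i => R i j :=
  ⟨fun i j => hx.1 j i, hx.2.2.1, hx.2.1, fun i j => hx.2.2.2 j i⟩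

lemma suppFace_transpose (R : I → J → Prop) :
    AffinelyEquivalent (suppFace R) (suppFace fun j i => R i j) :=
  .of_invOn (convex_suppFace R) Matrix.transpose Matrix.transpose
    (fun _ _ _ _ _ _ _ _ _ => rfl) (fun _ hx => transpose_mem_suppFace hx)
    (fun _ hx => transpose_mem_suppFace hx) (fun _ _ => rfl) (fun _ _ => rfl)

lemma card_eq_of_mem_suppFace {R : I → J → Prop} {x : Matrix I J ℝ} (hx : x ∈ suppFace R) :
    Fintype.card I = Fintype.card J := by
  have h : ∑ i, ∑ j, x i j = ∑ j, ∑ i, x i j := Finset.sum_comm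
  simp only [hx.2.1, hx.2.2.1, Finset.sum_const, nsmul_eq_mul, mul_one] at h
  exact_mod_cast h

/-- The disjoint union of two supports. -/
def sumRel (R : I → J → Prop) (R' : I' → J' → Prop) : I ⊕ I' → J ⊕ J' → Prop
  | .inl i, .inl j => R i j
  | .inr i, .inr j => R' i j
  | _, _ => False

lemma suppFace_sumRel (R : I → J → Prop) (R' : I' → J' → Prop) :
    AffinelyEquivalent (suppFace (sumRel R R')) (suppFace R ×ˢ suppFace R') := by
  have h12 : ∀ x ∈ suppFace (sumRel R R'), x.toBlocks₁₂ = 0 := fun x hx => by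
    ext i j
    exact hx.2.2.2 _ _ (by simp [sumRel])
  have h21 : ∀ x ∈ suppFace (sumRel R R'), x.toBlocks₂₁ = 0 := fun x hx => by
    ext i j
    exact hx.2.2.2 _ _ (by simp [sumRel])
  refine .of_invOn (convex_suppFace _) (fun x => (x.toBlocks₁₁, x.toBlocks₂₂))
    (fun y => Matrix.fromBlocks y.1 0 0 y.2) (fun _ _ _ _ _ _ _ _ _ => rfl) ?_ ?_ ?_ ?_
  · intro x hx
    have h12' := fun i j => congrFun₂ (h12 x hx) i j
    have h21' := fun i j => congrFun₂ (h21 x hx) i j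
    simp only [Matrix.toBlocks₁₂, Matrix.toBlocks₂₁, Matrix.of_apply, Matrix.zero_apply]
      at h12' h21'
    obtain ⟨h₁, h₂, h₃, h₄⟩ := hx
    refine ⟨⟨fun i j => h₁ _ _, fun i => ?_, fun j => ?_, fun i j h => h₄ _ _ h⟩,
      ⟨fun i j => h₁ _ _, fun i => ?_, fun j => ?_, fun i j h => h₄ _ _ h⟩⟩
    · simpa [h12', Matrix.toBlocks₁₁] using h₂ (.inl i)
    · simpa [h21', Matrix.toBlocks₁₁] using h₃ (.inl j)
    · simpa [h21', Matrix.toBlocks₂₂] using h₂ (.inr i)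
    · simpa [h12', Matrix.toBlocks₂₂] using h₃ (.inr j)
  · rintro ⟨x, y⟩ ⟨hx, hy⟩
    refine ⟨?_, ?_, ?_, ?_⟩
    · rintro (i | i) (j | j)
      · exact hx.1 i j
      · exact le_rfl
      · exact le_rfl
      · exact hy.1 i j
    · rintro (i | i)
      · simpa using hx.2.1 i
      · simpa using hy.2.1 i
    · rintro (i | i)
      · simpa using hx.2.2.1 i
      · simpa using hy.2.2.1 i
    · rintro (i | i) (j | j) h
      · exact hx.2.2.2 i j h
      · rfl
      · rfl
      · exact hy.2.2.2 i j h
  · intro x hx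
    conv_rhs => rw [← Matrix.fromBlocks_toBlocks x, h12 x hx, h21 x hx]
  · intro x _
    simp

variable {C : Type*} (p : I → C) (q : J → C)

/-- The restriction of `R` to a fibre of a labelling of its nodes. -/
def fibreRel (R : I → J → Prop) (c : C) (i : {i // p i = c}) (j : {j // q j = c}) : Prop :=
  R i j

lemma sum_fibre_of_eq_zero {q : J → C} {c : C} {f : J → ℝ} (h : ∀ j, q j ≠ c → f j = 0) :
    ∑ j : {j // q j = c}, f j = ∑ j, f j := by
  rw [← Finset.sum_filter_of_ne (p := fun j => q j = c)]
  · exact (Finset.sum_subtype _ (by simp) f).symm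
  · intro j _ hj
    by_contra hq
    exact hj (h j hq)

variable {p q} {R : I → J → Prop}

lemma fibre_mem_suppFace (hR : ∀ i j, R i j → p i = q j) {x : Matrix I J ℝ}
    (hx : x ∈ suppFace R) (c : C) :
    (fun i j => x i j : Matrix {i // p i = c} {j // q j = c} ℝ) ∈
      suppFace (fibreRel p q R c) := by
  refine ⟨fun i j => hx.1 _ _, fun i => ?_, fun j => ?_, fun i j h => hx.2.2.2 _ _ h⟩
  · refine (sum_fibre_of_eq_zero fun j hj => hx.2.2.2 _ _ fun h => hj ?_).trans (hx.2.1 i)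
    rw [← hR _ _ h, i.2]
  · refine (sum_fibre_of_eq_zero (f := fun i => x i j)
      fun i hi => hx.2.2.2 _ _ fun h => hi ?_).trans (hx.2.2.1 j)
    rw [hR _ _ h, j.2]

lemma suppFace_pi (hR : ∀ i j, R i j → p i = q j) :
    AffinelyEquivalent (suppFace R) (univ.pi fun c => suppFace (fibreRel p q R c)) := by
  have hfib : ∀ (i : I) (j : J), p i = q j →
      ∃ c, ∃ (i' : {i // p i = c}) (j' : {j // q j = c}), i'.1 = i ∧ j'.1 = j :=
    fun i j h => ⟨q j, ⟨i, h⟩, ⟨j, rfl⟩, rfl, rfl⟩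
  refine .of_invOn (convex_suppFace _) (fun x c i j => x i j) glueFibres
    (fun _ _ _ _ _ _ _ _ _ => rfl) (fun x hx c _ => fibre_mem_suppFace hR hx c) ?_ ?_ ?_
  · intro y hy
    refine ⟨fun i j => ?_, fun i => ?_, fun j => ?_, fun i j h => ?_⟩
    · by_cases hij : p i = q j
      · obtain ⟨c, i, j, rfl, rfl⟩ := hfib i j hij
        rw [glueFibres_apply]
        exact (hy _ trivial).1 _ _
      · rw [glueFibres_of_ne y hij]
    · rw [← sum_fibre_of_eq_zero (q := q) (c := p i)
        fun j hj => glueFibres_of_ne y (Ne.symm hj), ← (hy (p i) trivial).2.1 ⟨i, rfl⟩]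
      exact Finset.sum_congr rfl fun j _ => glueFibres_apply y (p i) ⟨i, rfl⟩ j
    · rw [← sum_fibre_of_eq_zero (q := p) (c := q j) (f := fun i => glueFibres y i j)
        fun i hi => glueFibres_of_ne y hi, ← (hy (q j) trivial).2.2.1 ⟨j, rfl⟩]
      exact Finset.sum_congr rfl fun i _ => glueFibres_apply y (q j) i ⟨j, rfl⟩
    · by_cases hij : p i = q j
      · obtain ⟨c, i, j, rfl, rfl⟩ := hfib i j hij
        rw [glueFibres_apply]
        exact (hy _ trivial).2.2.2 _ _ h
      · rw [glueFibres_of_ne y hij]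
  · intro x hx
    ext i j
    by_cases hij : p i = q j
    · obtain ⟨c, i, j, rfl, rfl⟩ := hfib i j hij
      exact glueFibres_apply (fun c i j => x i j) c i j
    · refine (glueFibres_of_ne _ hij).trans ?_
      exact (hx.2.2.2 _ _ fun h => hij (hR _ _ h)).symm
  · intro y hy
    funext c i j
    exact glueFibres_apply y c i j

lemma suppFace_contract_option {R : Option I → Option (Option J) → Prop}
    (hv : ∀ j, ¬ R none (some (some j))) (hu : ∀ i, R (some i) none → ¬ R (some i) (some none))
    (h₁ : ¬ R none (some none) → ∀ i, ¬ R (some i) none)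
    (h₂ : ¬ R none none → ∀ i, ¬ R (some i) (some none)) :
    AffinelyEquivalent (suppFace R) (suppFace fun (i : I) (j : Option J) =>
      R (some i) (some j) ∨ j = none ∧ R (some i) none) := by
  set R' : I → Option J → Prop := fun i j => R (some i) (some j) ∨ j = none ∧ R (some i) none
    with hR'
  let f (x : Matrix (Option I) (Option (Option J)) ℝ) : Matrix I (Option J) ℝ := fun i j =>
    x (some i) (some j) + if j = none then x (some i) none else 0
  let A (y : Matrix I (Option J) ℝ) (i : I) : ℝ := if R (some i) none then y i none else 0
  let B (y : Matrix I (Option J) ℝ) (i : I) : ℝ := if R (some i) (some none) then y i none else 0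
  let g (y : Matrix I (Option J) ℝ) : Matrix (Option I) (Option (Option J)) ℝ
    | none, none => ∑ i, B y i
    | none, some none => ∑ i, A y i
    | none, some (some _) => 0
    | some i, none => A y i
    | some i, some none => B y i
    | some i, some (some j) => y i (some j)
  have hAB : ∀ y ∈ suppFace R', ∀ i, A y i + B y i = y i none := by
    intro y hy i
    simp only [A, B]
    by_cases ha : R (some i) none
    · simp [ha, hu i ha]
    · by_cases hb : R (some i) (some none)
      · simp [ha, hb]
      · simp [ha, hb, hy.2.2.2 i none (by simp [hR', ha, hb])]
  have hA0 : ∀ y ∈ suppFace R', ∀ i, 0 ≤ A y i := by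
    intro y hy i
    simp only [A]
    split_ifs
    exacts [hy.1 _ _, le_rfl]
  have hB0 : ∀ y ∈ suppFace R', ∀ i, 0 ≤ B y i := by
    intro y hy i
    simp only [B]
    split_ifs
    exacts [hy.1 _ _, le_rfl]
  have hsum : ∀ y ∈ suppFace R', ∑ i, A y i + ∑ i, B y i = 1 := by
    intro y hy
    rw [← Finset.sum_add_distrib, ← hy.2.2.1 none]
    exact Finset.sum_congr rfl fun i _ => hAB y hy i
  have hA : ∀ x ∈ suppFace R, ∀ i, A (f x) i = x (some i) none := by
    intro x hx i
    simp only [A, f, if_true]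
    split_ifs with h
    · rw [hx.2.2.2 _ _ (hu i h), zero_add]
    · exact (hx.2.2.2 _ _ h).symm
  have hB : ∀ x ∈ suppFace R, ∀ i, B (f x) i = x (some i) (some none) := by
    intro x hx i
    simp only [B, f, if_true]
    split_ifs with h
    · rw [hx.2.2.2 _ none (fun h' => hu i h' h), add_zero]
    · exact (hx.2.2.2 _ _ h).symm
  have hrow : ∀ x ∈ suppFace R, x none none + x none (some none) = 1 := by
    intro x hx
    have := hx.2.1 none
    rw [Fintype.sum_option, Fintype.sum_option,
      Finset.sum_eq_zero fun j _ => hx.2.2.2 _ _ (hv j), add_zero] at this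
    exact this
  refine .of_invOn (convex_suppFace _) f g ?_ ?_ ?_ ?_ ?_
  · intro x _ y _ a b _ _ _
    ext i j
    rw [Matrix.add_apply, Matrix.smul_apply, Matrix.smul_apply]
    simp only [f, Matrix.add_apply, Matrix.smul_apply, smul_eq_mul]
    split_ifs <;> ring
  · intro x hx
    refine ⟨fun i j => ?_, fun i => ?_, fun j => ?_, fun i j h => ?_⟩
    · have h1 := hx.1 (some i) (some j)
      have h2 := hx.1 (some i) none
      dsimp only [f]
      split_ifs <;> linarith
    · have := hx.2.1 (some i)
      rw [Fintype.sum_option, Fintype.sum_option] at this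
      simp only [f, Fintype.sum_option, if_true, reduceCtorEq, if_false, add_zero]
      linarith
    · rcases j with _ | j
      · have h1 := hx.2.2.1 none
        have h2 := hx.2.2.1 (some none)
        rw [Fintype.sum_option] at h1 h2
        simp only [f, if_true, Finset.sum_add_distrib]
        linarith [hrow x hx]
      · have h1 := hx.2.2.1 (some (some j))
        rw [Fintype.sum_option, hx.2.2.2 _ _ (hv j), zero_add] at h1
        simpa [f] using h1
    · simp only [hR', not_or, not_and] at h
      simp only [f, hx.2.2.2 _ _ h.1, zero_add]
      split_ifs with hj
      · exact hx.2.2.2 _ _ (h.2 hj)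
      · rfl
  · intro y hy
    refine ⟨?_, ?_, ?_, ?_⟩
    · rintro (_ | i) (_ | _ | j)
      · exact Finset.sum_nonneg fun i _ => hB0 y hy i
      · exact Finset.sum_nonneg fun i _ => hA0 y hy i
      · exact le_rfl
      · exact hA0 y hy i
      · exact hB0 y hy i
      · exact hy.1 _ _
    · rintro (_ | i)
      · simp only [Fintype.sum_option, g, Finset.sum_const_zero]
        linarith [hsum y hy]
      · have h1 := hy.2.1 i
        simp only [Fintype.sum_option, g] at h1 ⊢
        linarith [hAB y hy i]
    · rintro (_ | _ | j)
      · simp only [Fintype.sum_option, g]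
        linarith [hsum y hy]
      · simp only [Fintype.sum_option, g]
        linarith [hsum y hy]
      · simpa [Fintype.sum_option, g] using hy.2.2.1 (some j)
    · rintro (_ | i) (_ | _ | j) h
      · exact Finset.sum_eq_zero fun i _ => if_neg (h₂ h i)
      · exact Finset.sum_eq_zero fun i _ => if_neg (h₁ h i)
      · rfl
      · exact if_neg h
      · exact if_neg h
      · exact hy.2.2.2 _ _ (by simpa [hR'] using h)
  · intro x hx
    have h1 := hx.2.2.1 none
    have h2 := hx.2.2.1 (some none)
    have h3 := hrow x hx
    rw [Fintype.sum_option] at h1 h2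
    ext (_ | i) (_ | _ | j)
    · simp only [g, hB x hx]
      linarith
    · simp only [g, hA x hx]
      linarith
    · exact (hx.2.2.2 _ _ (hv j)).symm
    · exact hA x hx i
    · exact hB x hx i
    · simp [g, f]
  · intro y hy
    ext i (_ | j)
    · simp only [f, g, if_true]
      rw [add_comm]
      exact hAB y hy i
    · simp [f, g]

/-- Merging the two columns `w₁, w₂` of a row `v` without further entries, when no other row meets
both of them. -/
lemma suppFace_contract {v : I} {w₁ w₂ : J} (hw : w₁ ≠ w₂) (hv : ∀ j, R v j → j = w₁ ∨ j = w₂)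
    (hu : ∀ u, u ≠ v → R u w₁ → ¬ R u w₂) (h₁ : ¬ R v w₁ → ∀ u, u ≠ v → ¬ R u w₂)
    (h₂ : ¬ R v w₂ → ∀ u, u ≠ v → ¬ R u w₁) :
    AffinelyEquivalent (suppFace R) (suppFace fun (i : {i // i ≠ v})
      (j : Option {j : {j // j ≠ w₂} // j ≠ ⟨w₁, hw⟩}) =>
      R i (Equiv.optionSubtypeNe _ j).1 ∨ j = none ∧ R i w₂) := by
  let e : Option {i // i ≠ v} ≃ I := Equiv.optionSubtypeNe v
  let e' : Option (Option {j : {j // j ≠ w₂} // j ≠ ⟨w₁, hw⟩}) ≃ J :=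
    (Equiv.optionCongr (Equiv.optionSubtypeNe _)).trans (Equiv.optionSubtypeNe w₂)
  refine (suppFace_reindex R e.symm e'.symm (fun i j => R (e i) (e' j)) (by simp)).trans ?_
  have hn : e none = v := rfl
  have hs : ∀ i, e (some i) = i := fun i => rfl
  have hn' : e' none = w₂ := rfl
  have hs' : ∀ j, e' (some j) = (Equiv.optionSubtypeNe _ j).1 := fun i => rfl
  have := suppFace_contract_option (R := fun i j => R (e i) (e' j)) ?_ ?_ ?_ ?_
  · exact this
  · intro j hj
    rcases hv _ hj with h | h
    · exact j.2 (Subtype.ext h)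
    · exact j.1.2 h
  · exact fun i h h' => hu i i.2 h' h
  · exact fun h i => h₁ h i i.2
  · exact fun h i => h₂ h i i.2

end SuppFace

section Shapes

lemma suppFace_full_two :
    AffinelyEquivalent (suppFace fun _ _ : Fin 2 => True) (Icc (0 : ℝ) 1) := by
  refine .of_invOn (convex_suppFace _) (fun x => x 0 0) (fun t => !![t, 1 - t; 1 - t, t])
    (fun _ _ _ _ _ _ _ _ _ => rfl) ?_ ?_ ?_ ?_
  · intro x hx
    have h1 := hx.2.1 0
    have h2 := hx.1 0 1
    rw [Fin.sum_univ_two] at h1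
    exact ⟨hx.1 0 0, by linarith⟩
  · rintro t ⟨h0, h1⟩
    refine ⟨?_, ?_, ?_, fun _ _ h => (h trivial).elim⟩
    · simp [Fin.forall_fin_two, h0, h1]
    · simp [Fin.forall_fin_two]
    · simp [Fin.forall_fin_two]
  · intro x hx
    have h1 := hx.2.1 0
    have h2 := hx.2.2.1 0
    have h3 := hx.2.2.1 1
    rw [Fin.sum_univ_two] at h1 h2 h3
    ext i j
    fin_cases i <;> fin_cases j <;> simp <;> linarith
  · intro t _
    simp

lemma stdSimplex_reindex {J : Type*} [Fintype J] {k : ℕ} (hk : Fintype.card J = k) :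
    AffinelyEquivalent (stdSimplex ℝ J) (stdSimplex ℝ (Fin k)) := by
  let e : J ≃ Fin k := Fintype.equivFinOfCardEq hk
  refine .of_invOn (convex_stdSimplex ℝ J) (fun x i => x (e.symm i)) (fun x i => x (e i))
    (fun _ _ _ _ _ _ _ _ _ => rfl) ?_ ?_ ?_ ?_
  · exact fun x hx => ⟨fun i => hx.1 _, (e.symm.sum_comp x).trans hx.2⟩
  · exact fun x hx => ⟨fun i => hx.1 _, (e.sum_comp x).trans hx.2⟩
  · exact fun x _ => funext fun i => by simp
  · exact fun x _ => funext fun i => by simp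

/-- The support with a single zero in a `3 × 3` matrix gives a tetrahedron. -/
lemma suppFace_tetrahedron :
    AffinelyEquivalent (suppFace fun i j : Fin 3 => i ≠ 0 ∨ j ≠ 0) (stdSimplex ℝ (Fin 4)) := by
  refine .of_invOn (convex_suppFace _) (fun x => ![x 1 1, x 1 2, x 2 1, x 2 2])
    (fun y => !![0, y 1 + y 3, y 0 + y 2; y 2 + y 3, y 0, y 1; y 0 + y 1, y 2, y 3]) ?_ ?_ ?_ ?_ ?_
  · intro x _ y _ a b _ _ _
    ext i
    fin_cases i <;> simp
  · rintro x ⟨h0, hr, hc, hz⟩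
    have hz' := hz 0 0 (by simp)
    simp only [Fin.sum_univ_three] at hr hc
    refine ⟨fun i => ?_, ?_⟩
    · fin_cases i <;> exact h0 _ _
    · simp only [Fin.sum_univ_four, Matrix.cons_val]
      linarith [hr 0, hr 1, hr 2, hc 0, hc 1, hc 2]
  · rintro y ⟨h0, hs⟩
    simp only [Fin.sum_univ_four] at hs
    refine ⟨?_, ?_, ?_, ?_⟩
    · intro i j
      fin_cases i <;> fin_cases j <;> simp <;> linarith [h0 0, h0 1, h0 2, h0 3]
    · intro i
      simp only [Fin.sum_univ_three]
      fin_cases i <;> simp <;> linarith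
    · intro i
      simp only [Fin.sum_univ_three]
      fin_cases i <;> simp <;> linarith
    · intro i j h
      simp only [ne_eq, not_or, not_not] at h
      simp [h.1, h.2]
  · rintro x ⟨h0, hr, hc, hz⟩
    have hz' := hz 0 0 (by simp)
    simp only [Fin.sum_univ_three] at hr hc
    ext i j
    fin_cases i <;> fin_cases j <;> simp <;> linarith [hr 0, hr 1, hr 2, hc 0, hc 1, hc 2]
  · intro y _
    ext i
    fin_cases i <;> rfl

lemma mem_cubePyramid {d : ℕ} {x : (Fin d → ℝ) × ℝ} :
    x ∈ cubePyramid d ↔ 0 ≤ x.2 ∧ x.2 ≤ 1 ∧ (∀ i, 0 ≤ x.1 i) ∧ ∀ i, x.1 i + x.2 ≤ 1 := by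
  constructor
  · have hconv : Convex ℝ {x : (Fin d → ℝ) × ℝ |
        0 ≤ x.2 ∧ x.2 ≤ 1 ∧ (∀ i, 0 ≤ x.1 i) ∧ ∀ i, x.1 i + x.2 ≤ 1} := by
      rintro x ⟨h₁, h₂, h₃, h₄⟩ y ⟨k₁, k₂, k₃, k₄⟩ a b ha hb hab
      refine ⟨?_, ?_, fun i => ?_, fun i => ?_⟩
      · exact add_nonneg (mul_nonneg ha h₁) (mul_nonneg hb k₁)
      · have := mul_le_mul_of_nonneg_left h₂ ha
        have := mul_le_mul_of_nonneg_left k₂ hb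
        simp only [Prod.snd_add, Prod.smul_snd, smul_eq_mul]
        linarith
      · exact add_nonneg (mul_nonneg ha (h₃ i)) (mul_nonneg hb (k₃ i))
      · have := mul_le_mul_of_nonneg_left (h₄ i) ha
        have := mul_le_mul_of_nonneg_left (k₄ i) hb
        simp only [Prod.snd_add, Prod.smul_snd, smul_eq_mul, Prod.fst_add, Prod.smul_fst,
          Pi.add_apply, Pi.smul_apply]
        linarith
    intro hx
    refine convexHull_min ?_ hconv hx
    rintro y (⟨⟨h₁, h₂⟩, h₃⟩ | rfl)
    · rw [mem_singleton_iff] at h₃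
      simp only [mem_ofPred_eq, h₃]
      exact ⟨le_rfl, zero_le_one, h₁, fun i => by simpa using h₂ i⟩
    · simp
  · obtain ⟨p, s⟩ := x
    rintro ⟨h₁, h₂, h₃, h₄⟩
    dsimp only at h₁ h₂ h₃ h₄
    have hapex : ((0 : Fin d → ℝ), (1 : ℝ)) ∈ cubePyramid d :=
      subset_convexHull ℝ _ (Or.inr rfl)
    rcases h₂.eq_or_lt with rfl | hs
    · have : p = 0 := funext fun i => le_antisymm (by simpa using h₄ i) (h₃ i)
      rwa [this]
    · have hs' : 0 < 1 - s := by linarith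
      have hbase : ((1 - s)⁻¹ • p, (0 : ℝ)) ∈ cubePyramid d := by
        refine subset_convexHull ℝ _ (Or.inl ⟨⟨fun i => ?_, fun i => ?_⟩, rfl⟩)
        · exact mul_nonneg (inv_nonneg.2 hs'.le) (h₃ i)
        · simp only [Pi.smul_apply, smul_eq_mul, Pi.one_apply]
          rw [inv_mul_le_one₀ hs']
          linarith [h₄ i]
      have := convex_convexHull ℝ _ hbase hapex hs'.le h₁ (by ring)
      convert! this using 1
      ext i
      · simp [hs'.ne']
      · simp

variable {K : Type*} [Fintype K]

/-- The support consisting of a cyclic chain of `2 × 2` blocks, linked by single entries. -/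
def chainRel (π : K → K) : K ⊕ K → K ⊕ K → Prop
  | .inl k, .inl l => k = l ∨ l = π k
  | .inl k, .inr l => k = l
  | .inr k, .inl l => k = l
  | .inr k, .inr l => k = l

/-- A cyclic chain of blocks gives a pyramid over a cube. -/
lemma suppFace_chainRel (π : Equiv.Perm K) (hπ : ∀ k, π k ≠ k)
    (htrans : ∀ A : Set K, (∀ k ∈ A, π k ∈ A) → A.Nonempty → A = univ) (k₀ : K)
    {d : ℕ} (hd : Fintype.card K = d) :
    AffinelyEquivalent (suppFace (chainRel π)) (cubePyramid d) := by
  let e : K ≃ Fin d := Fintype.equivFinOfCardEq hd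
  let g (y : (Fin d → ℝ) × ℝ) : Matrix (K ⊕ K) (K ⊕ K) ℝ
    | .inl k, .inl l => (if k = l then 1 - y.2 - y.1 (e k) else 0) + if l = π k then y.2 else 0
    | .inl k, .inr l => if k = l then y.1 (e k) else 0
    | .inr k, .inl l => if k = l then y.1 (e k) else 0
    | .inr k, .inr l => if k = l then 1 - y.1 (e k) else 0
  have hinv : ∀ (y : ℝ) (j : K), (∑ k, if j = π k then y else 0) = y := by
    intro y j
    rw [← π.symm.sum_comp]
    simp
  have hr₁ : ∀ x ∈ suppFace (chainRel π), ∀ k,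
      x (.inl k) (.inl k) + x (.inl k) (.inl (π k)) + x (.inl k) (.inr k) = 1 := by
    intro x hx k
    have h := hx.2.1 (.inl k)
    rw [Fintype.sum_sum_type, Finset.sum_eq_single (f := fun l => x (.inl k) (.inr l)) k,
      Finset.sum_eq_add (f := fun l => x (.inl k) (.inl l)) k (π k) (hπ k).symm] at h
    · exact h
    · exact fun l _ hl => hx.2.2.2 _ _ (by simpa [chainRel, Ne.symm hl.1, eq_comm] using hl.2)
    · simp
    · simp
    · exact fun l _ hl => hx.2.2.2 _ _ (by simpa [chainRel, eq_comm] using hl)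
    · simp
  have hr₂ : ∀ x ∈ suppFace (chainRel π), ∀ k, x (.inr k) (.inl k) + x (.inr k) (.inr k) = 1 := by
    intro x hx k
    have h := hx.2.1 (.inr k)
    rw [Fintype.sum_sum_type, Finset.sum_eq_single (f := fun l => x (.inr k) (.inr l)) k,
      Finset.sum_eq_single (f := fun l => x (.inr k) (.inl l)) k] at h
    · exact h
    · exact fun l _ hl => hx.2.2.2 _ _ (by simpa [chainRel, eq_comm] using hl)
    · simp
    · exact fun l _ hl => hx.2.2.2 _ _ (by simpa [chainRel, eq_comm] using hl)
    · simp
  have hc₂ : ∀ x ∈ suppFace (chainRel π), ∀ k, x (.inl k) (.inr k) + x (.inr k) (.inr k) = 1 := by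
    intro x hx k
    have h := hx.2.2.1 (.inr k)
    rw [Fintype.sum_sum_type, Finset.sum_eq_single (f := fun l => x (.inr l) (.inr k)) k,
      Finset.sum_eq_single (f := fun l => x (.inl l) (.inr k)) k] at h
    · exact h
    · exact fun l _ hl => hx.2.2.2 _ _ (by simpa [chainRel] using hl)
    · simp
    · exact fun l _ hl => hx.2.2.2 _ _ (by simpa [chainRel] using hl)
    · simp
  have hc₁ : ∀ x ∈ suppFace (chainRel π), ∀ k, x (.inl (π k)) (.inl (π k)) +
      x (.inl k) (.inl (π k)) + x (.inr (π k)) (.inl (π k)) = 1 := by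
    intro x hx k
    have h := hx.2.2.1 (.inl (π k))
    rw [Fintype.sum_sum_type, Finset.sum_eq_single (f := fun l => x (.inr l) (.inl (π k))) (π k),
      Finset.sum_eq_add (f := fun l => x (.inl l) (.inl (π k))) (π k) k (hπ k)] at h
    · exact h
    · exact fun l _ hl => hx.2.2.2 _ _ (by simpa [chainRel, hl.1, eq_comm] using hl.2)
    · simp
    · simp
    · exact fun l _ hl => hx.2.2.2 _ _ (by simpa [chainRel] using hl)
    · simp
  have hs : ∀ x ∈ suppFace (chainRel π), ∀ k,
      x (.inl k) (.inl (π k)) = x (.inl k₀) (.inl (π k₀)) := by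
    intro x hx
    refine eq_univ_iff_forall.1 (htrans {k | x (.inl k) (.inl (π k)) = x (.inl k₀) (.inl (π k₀))}
      (fun k hk => ?_) ⟨k₀, rfl⟩)
    have hk' : x (.inl k) (.inl (π k)) = x (.inl k₀) (.inl (π k₀)) := hk
    change x (.inl (π k)) (.inl (π (π k))) = x (.inl k₀) (.inl (π k₀))
    linarith [hr₁ x hx (π k), hr₂ x hx (π k), hc₂ x hx (π k), hc₁ x hx k]
  refine .of_invOn (convex_suppFace _)
    (fun x => (fun i => x (.inr (e.symm i)) (.inl (e.symm i)), x (.inl k₀) (.inl (π k₀)))) g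
    (fun _ _ _ _ _ _ _ _ _ => rfl) ?_ ?_ ?_ ?_
  · intro x hx
    rw [mem_cubePyramid]
    refine ⟨hx.1 _ _, ?_, fun i => hx.1 _ _, fun i => ?_⟩
    · dsimp only
      linarith [hr₁ x hx k₀, hx.1 (.inl k₀) (.inl k₀), hx.1 (.inl k₀) (.inr k₀)]
    · dsimp only
      set k := e.symm i
      linarith [hr₁ x hx k, hx.1 (.inl k) (.inl k), hr₂ x hx k, hc₂ x hx k, hs x hx k]
  · intro y hy
    obtain ⟨h₁, h₂, h₃, h₄⟩ := mem_cubePyramid.1 hy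
    refine ⟨?_, ?_, ?_, ?_⟩
    · have hk := fun k => h₃ (e k)
      have hk' := fun k => h₄ (e k)
      rintro (k | k) (l | l) <;> dsimp only [g]
      · refine add_nonneg ?_ ?_ <;> split_ifs <;> linarith [hk k, hk' k]
      · split_ifs <;> linarith [hk k, hk' k]
      · split_ifs <;> linarith [hk k, hk' k]
      · split_ifs <;> linarith [hk k, hk' k]
    · rintro (k | k)
      · simp [Fintype.sum_sum_type, g, Finset.sum_add_distrib]
        ring
      · simp [Fintype.sum_sum_type, g]
    · rintro (k | k)
      · simp [Fintype.sum_sum_type, g, Finset.sum_add_distrib, hinv]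
        ring
      · simp [Fintype.sum_sum_type, g]
    · rintro (k | k) (l | l) h <;> simp_all [chainRel, g]
  · intro x hx
    ext (k | k) (l | l)
    · by_cases hkl : k = l
      · subst hkl
        simp only [g, if_true, (hπ k).symm, if_false, e.symm_apply_apply]
        linarith [hr₁ x hx k, hr₂ x hx k, hc₂ x hx k, hs x hx k]
      · by_cases hl : l = π k
        · subst hl
          simp [g, hkl, hs x hx k]
        · simp [g, hkl, hl, hx.2.2.2 (.inl k) (.inl l) (by simp [chainRel, hkl, hl])]
    · by_cases hkl : k = l
      · subst hkl
        simp only [g, if_true, e.symm_apply_apply]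
        linarith [hr₂ x hx k, hc₂ x hx k]
      · simp [g, hkl, hx.2.2.2 (.inl k) (.inr l) (by simp [chainRel, hkl])]
    · by_cases hkl : k = l
      · subst hkl
        simp [g]
      · simp [g, hkl, hx.2.2.2 (.inr k) (.inl l) (by simp [chainRel, hkl])]
    · by_cases hkl : k = l
      · subst hkl
        simp only [g, if_true, e.symm_apply_apply]
        linarith [hr₂ x hx k, hc₂ x hx k]
      · simp [g, hkl, hx.2.2.2 (.inr k) (.inr l) (by simp [chainRel, hkl])]
  · intro y _
    ext i
    · simp [g]
    · simp [g, (hπ k₀).symm]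

end Shapes

section Components

variable {I J : Type*} [Fintype J]

/-- The number of columns related to the row `i`. -/
noncomputable def rowDeg (R : I → J → Prop) (i : I) : ℕ :=
  (Finset.univ.filter (R i)).card

lemma exists_of_rowDeg_eq_two {R : I → J → Prop} {i : I} (h : rowDeg R i = 2) :
    ∃ w₁ w₂, w₁ ≠ w₂ ∧ ∀ j, R i j ↔ j = w₁ ∨ j = w₂ := by
  obtain ⟨w₁, w₂, hne, hw⟩ := Finset.card_eq_two.1 h
  refine ⟨w₁, w₂, hne, fun j => ?_⟩
  have := congrArg (j ∈ ·) hw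
  simpa using this

variable [Fintype I]

/-- A connected support with positive surplus and minimal degree two, whose rows are
irreducible. -/
structure IsIndecomposable (R : I → J → Prop) : Prop where
  nonempty : Nonempty I
  hall : ∀ (S : Finset I) (T : Finset J), S.Nonempty → (∀ i ∈ S, ∀ j, R i j → j ∈ T) →
    T.card ≤ S.card → S = Finset.univ ∧ T = Finset.univ
  two_le : ∀ i, 2 ≤ rowDeg R i
  irreducible : ∀ v w₁ w₂, w₁ ≠ w₂ → (∀ j, R v j ↔ j = w₁ ∨ j = w₂) →
    ∃ u, u ≠ v ∧ R u w₁ ∧ R u w₂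

/-- Rows have degree two or three, and are matched in pairs with nested neighbourhoods. -/
def IsTight (R : I → J → Prop) : Prop :=
  (∀ i, rowDeg R i = 2 ∨ rowDeg R i = 3) ∧
    ∃ v : {u // rowDeg R u = 3} → I, Function.Injective v ∧
      (∀ i, rowDeg R i = 2 ↔ ∃ k, v k = i) ∧ ∀ k j, R (v k) j → R k j

variable {R : I → J → Prop}

namespace IsIndecomposable

lemma exists_partner (h : IsIndecomposable R) {v : I} (hv : rowDeg R v = 2) :
    ∃ u, u ≠ v ∧ ∀ j, R v j → R u j := by
  obtain ⟨w₁, w₂, hne, hw⟩ := exists_of_rowDeg_eq_two hv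
  obtain ⟨u, hu, h₁, h₂⟩ := h.irreducible v w₁ w₂ hne hw
  refine ⟨u, hu, fun j hj => ?_⟩
  rcases (hw j).1 hj with rfl | rfl
  exacts [h₁, h₂]

lemma full_of_rowDeg_eq_two (h : IsIndecomposable R) {u v : I} (huv : u ≠ v)
    (hv : rowDeg R v = 2) (hu : rowDeg R u = 2) (hR : ∀ j, R v j → R u j) :
    Fintype.card I = 2 ∧ ∑ i, rowDeg R i = 4 ∧ ∀ i j, R i j := by
  have hsub : Finset.univ.filter (R v) ⊆ Finset.univ.filter (R u) := by
    intro j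
    simpa using hR j
  have heq := Finset.eq_of_subset_of_card_le hsub (by
    change rowDeg R u ≤ rowDeg R v
    omega)
  obtain ⟨hS, hT⟩ := h.hall {u, v} (Finset.univ.filter (R u)) (by simp) (by simpa using hR) (by
    rw [Finset.card_pair huv]
    exact hu.le)
  refine ⟨?_, ?_, fun i j => ?_⟩
  · rw [← Finset.card_univ, ← hS, Finset.card_pair huv]
  · rw [← hS, Finset.sum_pair huv, hu, hv]
  · have hi : i ∈ ({u, v} : Finset I) := hS ▸ Finset.mem_univ i
    have hj := Finset.eq_univ_iff_forall.1 hT j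
    rcases Finset.mem_insert.1 hi with rfl | hi
    · simpa using hj
    · rw [Finset.mem_singleton.1 hi]
      rw [← heq] at hj
      simpa using hj

/-- The three kinds of indecomposable supports, according to their number of entries. -/
lemma trichotomy (h : IsIndecomposable R) (hcard : Fintype.card I = Fintype.card J) :
    (Fintype.card I = 2 ∧ ∑ i, rowDeg R i = 4 ∧ ∀ i j, R i j) ∨
    (∃ u, (∀ j, R u j) ∧ (∀ v, v ≠ u → rowDeg R v = 2) ∧ 3 ≤ Fintype.card I ∧
      ∑ i, rowDeg R i + 2 = 3 * Fintype.card I) ∨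
    (5 * Fintype.card I ≤ 2 * ∑ i, rowDeg R i ∧
      (5 * Fintype.card I = 2 * ∑ i, rowDeg R i → IsTight R)) := by
  by_cases hfull : ∃ u v, u ≠ v ∧ rowDeg R v = 2 ∧ rowDeg R u = 2 ∧ ∀ j, R v j → R u j
  · obtain ⟨u, v, huv, hv, hu, hR⟩ := hfull
    exact Or.inl (h.full_of_rowDeg_eq_two huv hv hu hR)
  right
  push Not at hfull
  have hp : ∀ v, ∃ u, rowDeg R v = 2 → 3 ≤ rowDeg R u ∧ ∀ j, R v j → R u j := by
    intro v
    by_cases hv : rowDeg R v = 2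
    · obtain ⟨u, hu, hR⟩ := h.exists_partner hv
      refine ⟨u, fun _ => ⟨?_, hR⟩⟩
      by_contra hlt
      obtain ⟨j, hj, hj'⟩ := hfull u v hu hv (by have := h.two_le u; omega)
      exact hj' (hR j hj)
    · exact ⟨v, fun hv' => absurd hv' hv⟩
  choose p hp using hp
  set A : I → Finset I := fun u => Finset.univ.filter fun v => rowDeg R v = 2 ∧ p v = u with hA
  by_cases hex : ∃ u, 3 ≤ rowDeg R u ∧ rowDeg R u ≤ (A u).card + 1
  · left
    obtain ⟨u, hu, hle⟩ := hex
    have huA : u ∉ A u := by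
      simp only [hA, Finset.mem_filter, Finset.mem_univ, true_and, not_and]
      omega
    obtain ⟨hS, hT⟩ := h.hall (insert u (A u)) (Finset.univ.filter (R u)) (by simp) (by
      intro i hi j hj
      rcases Finset.mem_insert.1 hi with rfl | hi
      · simpa using hj
      · obtain ⟨hi₁, rfl⟩ := (Finset.mem_filter.1 hi).2
        simpa using (hp i hi₁).2 j hj) (by
      rw [Finset.card_insert_of_notMem huA]
      exact hle)
    have hdeg : rowDeg R u = Fintype.card I := by
      rw [hcard, rowDeg, hT, Finset.card_univ]
    have hcI : (A u).card + 1 = Fintype.card I := by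
      rw [← Finset.card_insert_of_notMem huA, hS, Finset.card_univ]
    refine ⟨u, fun j => ?_, fun v hv => ?_, hdeg ▸ hu, ?_⟩
    · have hj := Finset.eq_univ_iff_forall.1 hT j
      simpa using hj
    · have hv' : v ∈ insert u (A u) := hS ▸ Finset.mem_univ v
      have := (Finset.mem_insert.1 hv').resolve_left hv
      exact (Finset.mem_filter.1 this).2.1
    · rw [← hS, Finset.sum_insert huA,
        Finset.sum_congr rfl fun v hv => (Finset.mem_filter.1 hv).2.1,
        Finset.sum_const, smul_eq_mul]
      omega
  · right
    push Not at hex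
    set U₂ : Finset I := Finset.univ.filter fun v => rowDeg R v = 2 with hU₂
    set U₃ : Finset I := Finset.univ.filter fun v => 3 ≤ rowDeg R v with hU₃
    have hcompl : U₂ᶜ = U₃ := by
      ext v
      have := h.two_le v
      simp only [hU₂, hU₃, Finset.mem_compl, Finset.mem_filter, Finset.mem_univ, true_and]
      omega
    have hn : U₂.card + U₃.card = Fintype.card I := by
      rw [← hcompl, Finset.card_add_card_compl]
    have he : 2 * U₂.card + ∑ u ∈ U₃, rowDeg R u = ∑ u, rowDeg R u := by
      rw [← hcompl, ← Finset.sum_add_sum_compl U₂,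
        Finset.sum_congr (s₁ := U₂) rfl fun v hv => (Finset.mem_filter.1 hv).2,
        Finset.sum_const, smul_eq_mul, mul_comm]
    have hfib : U₂.card = ∑ u ∈ U₃, (A u).card := by
      rw [Finset.card_eq_sum_card_fiberwise (f := p) (t := U₃)]
      · simp only [hA, hU₂, Finset.filter_filter]
      · intro v hv
        simp only [hU₂, hU₃, Finset.coe_filter, Finset.mem_univ, true_and, mem_ofPred_eq] at hv ⊢
        exact (hp v hv).1
    have h₁ : ∀ u ∈ U₃, (A u).card + 2 ≤ rowDeg R u := fun u hu =>
      hex u (Finset.mem_filter.1 hu).2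
    have h₂ : ∀ u ∈ U₃, 3 ≤ rowDeg R u := fun u hu => (Finset.mem_filter.1 hu).2
    have hs₁ := Finset.sum_le_sum h₁
    have hs₂ := Finset.sum_le_sum h₂
    have hsum : ∑ u ∈ U₃, ((A u).card + 2) = U₂.card + 2 * U₃.card := by
      rw [Finset.sum_add_distrib, ← hfib, Finset.sum_const, smul_eq_mul, mul_comm]
    have hsum' : ∑ _u ∈ U₃, 3 = 3 * U₃.card := by
      rw [Finset.sum_const, smul_eq_mul, mul_comm]
    refine ⟨by omega, fun heq => ?_⟩
    have ht₁ := (Finset.sum_eq_sum_iff_of_le h₁).1 (by omega)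
    have ht₂ := (Finset.sum_eq_sum_iff_of_le h₂).1 (by omega)
    have hdeg : ∀ i, rowDeg R i = 2 ∨ rowDeg R i = 3 := by
      intro i
      by_cases hi : i ∈ U₃
      · exact Or.inr (ht₂ i hi).symm
      · have := h.two_le i
        simp only [hU₃, Finset.mem_filter, Finset.mem_univ, true_and] at hi
        omega
    have hone : ∀ k : {u // rowDeg R u = 3}, ∃ v, A k = {v} := by
      intro k
      have hk := ht₁ k (by simp [hU₃, k.2])
      rw [k.2] at hk
      exact Finset.card_eq_one.1 (by omega)
    choose v hv using hone
    have hvA : ∀ k, rowDeg R (v k) = 2 ∧ p (v k) = k := fun k => by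
      have : v k ∈ A k := by simp [hv k]
      simpa [hA] using this
    refine ⟨hdeg, v, fun k l hkl => ?_, fun i => ⟨fun hi => ?_, ?_⟩, fun k j hj => ?_⟩
    · rw [Subtype.ext_iff, ← (hvA k).2, hkl, (hvA l).2]
    · have hpi := hp i hi
      have hpi' : rowDeg R (p i) = 3 := (hdeg (p i)).resolve_left (by omega)
      have : i ∈ A (p i) := by simp [hA, hi]
      rw [hv ⟨p i, hpi'⟩, Finset.mem_singleton] at this
      exact ⟨_, this.symm⟩
    · rintro ⟨k, rfl⟩
      exact (hvA k).1
    · have := (hp (v k) (hvA k).1).2 j hj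
      rwa [(hvA k).2] at this

end IsIndecomposable

lemma exists_ne_of_sum_eq_zero {ι : Type*} [Fintype ι] {f : ι → ℝ} (h : ∑ i, f i = 0) {a : ι}
    (ha : f a ≠ 0) : ∃ b, b ≠ a ∧ f b ≠ 0 := by
  by_contra hcon
  push Not at hcon
  exact ha ((Fintype.sum_eq_single a hcon).symm.trans h)

/-- If all rows but `u` have degree two, a matrix in the face is determined by its row `u`. -/
lemma eq_of_row_eq (h : IsIndecomposable R) {u : I} (hd : ∀ v, v ≠ u → rowDeg R v = 2)
    {x y : Matrix I J ℝ} (hx : x ∈ suppFace R) (hy : y ∈ suppFace R) (hxy : x u = y u) :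
    x = y := by
  set z : I → J → ℝ := fun i j => x i j - y i j with hz
  have hrow : ∀ i, ∑ j, z i j = 0 := fun i => by simp [hz, hx.2.1, hy.2.1]
  have hcol : ∀ j, ∑ i, z i j = 0 := fun j => by simp [hz, hx.2.2.1, hy.2.2.1]
  have hsupp : ∀ i j, z i j ≠ 0 → R i j := fun i j hij => by
    by_contra hR
    exact hij (by simp [hz, hx.2.2.2 i j hR, hy.2.2.2 i j hR])
  by_contra hne
  set S : Finset I := Finset.univ.filter fun i => ∃ j, z i j ≠ 0 with hS
  set T : Finset J := Finset.univ.filter fun j => ∃ i, z i j ≠ 0 with hT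
  have huS : ∀ i ∈ S, i ≠ u := by
    rintro i hi rfl
    obtain ⟨j, hj⟩ := (Finset.mem_filter.1 hi).2
    exact hj (by simp [hz, hxy])
  have hSne : S.Nonempty := by
    by_contra hemp
    rw [Finset.not_nonempty_iff_eq_empty] at hemp
    refine hne (Matrix.ext fun i j => ?_)
    by_contra hij
    have : i ∈ S := by simpa [hS] using ⟨j, sub_ne_zero.2 hij⟩
    simp [hemp] at this
  have hcl : ∀ i ∈ S, ∀ j, R i j → j ∈ T := by
    intro i hi j hj
    obtain ⟨w₁, w₂, hw, hN⟩ := exists_of_rowDeg_eq_two (hd i (huS i hi))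
    obtain ⟨a, ha⟩ := (Finset.mem_filter.1 hi).2
    obtain ⟨b, hba, hb⟩ := exists_ne_of_sum_eq_zero (hrow i) ha
    simp only [hT, Finset.mem_filter, Finset.mem_univ, true_and]
    refine ⟨i, ?_⟩
    have ha' := (hN a).1 (hsupp i a ha)
    have hb' := (hN b).1 (hsupp i b hb)
    have hj' := (hN j).1 hj
    by_cases hja : j = a
    · exact hja ▸ ha
    · have : j = b := by grind
      exact this ▸ hb
  have hle := Finset.card_mul_le_card_mul (s := T) (t := S) (m := 2) (n := 2)
    (fun j i => z i j ≠ 0) (by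
      intro j hj
      obtain ⟨a, ha⟩ := (Finset.mem_filter.1 hj).2
      obtain ⟨b, hba, hb⟩ := exists_ne_of_sum_eq_zero (hcol j) ha
      rw [← Finset.card_pair hba]
      refine Finset.card_le_card fun i hi => ?_
      have hij : z i j ≠ 0 := by
        rcases Finset.mem_insert.1 hi with rfl | hi
        · exact hb
        · rwa [Finset.mem_singleton.1 hi]
      simp only [Finset.bipartiteAbove, Finset.mem_filter]
      exact ⟨Finset.mem_filter.2 ⟨Finset.mem_univ _, j, hij⟩, hij⟩) (by
      intro i hi
      rw [← hd i (huS i hi)]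
      refine Finset.card_le_card fun j hj => ?_
      simpa using hsupp i j (Finset.mem_filter.1 hj).2)
  have := (h.hall S T hSne hcl (by omega)).1
  exact huS u (this ▸ Finset.mem_univ u) rfl

/-- A matching through a given entry of a row. -/
lemma exists_bijective_of_hall (h : IsIndecomposable R)
    (hcard : Fintype.card I = Fintype.card J) {u : I} {j : J} (huj : R u j) :
    ∃ σ : I → J, Function.Bijective σ ∧ σ u = j ∧ ∀ i, R i (σ i) := by
  obtain ⟨φ, hφ, hφ'⟩ := (Finset.all_card_le_biUnion_card_iff_exists_injective
    fun i : {i // i ≠ u} => (Finset.univ.filter (R i)).erase j).1 (by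
    intro S
    rcases S.eq_empty_or_nonempty with rfl | hS
    · simp
    by_contra! hlt
    obtain ⟨hS', -⟩ := h.hall (S.map (Function.Embedding.subtype _))
      (insert j (S.biUnion fun i : {i // i ≠ u} => (Finset.univ.filter (R i)).erase j))
      (by simpa using hS) (by
        intro i hi k hk
        obtain ⟨i', hi', rfl⟩ := Finset.mem_map.1 hi
        by_cases hkj : k = j
        · simp [hkj]
        · refine Finset.mem_insert_of_mem (Finset.mem_biUnion.2 ⟨i', hi', ?_⟩)
          simpa [hkj] using hk) (by
        rw [Finset.card_map]
        exact (Finset.card_insert_le _ _).trans hlt)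
    obtain ⟨i, -, hi⟩ := Finset.mem_map.1 (hS' ▸ Finset.mem_univ u)
    exact i.2 hi)
  simp only [Finset.mem_erase, Finset.mem_filter, Finset.mem_univ, true_and] at hφ'
  let σ : I → J := fun i => if hi : i = u then j else φ ⟨i, hi⟩
  have hσu : σ u = j := dif_pos rfl
  have hσ : ∀ i (hi : i ≠ u), σ i = φ ⟨i, hi⟩ := fun i hi => dif_neg hi
  refine ⟨σ, ?_, hσu, fun i => ?_⟩
  · rw [Fintype.bijective_iff_injective_and_card]
    refine ⟨fun a b hab => ?_, hcard⟩
    by_cases ha : a = u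
    · by_cases hb : b = u
      · rw [ha, hb]
      · rw [ha, hσu, hσ b hb] at hab
        exact absurd hab.symm (hφ' ⟨b, hb⟩).1
    · by_cases hb : b = u
      · rw [hb, hσu, hσ a ha] at hab
        exact absurd hab (hφ' ⟨a, ha⟩).1
      · rw [hσ a ha, hσ b hb] at hab
        exact congrArg Subtype.val (hφ hab)
  · by_cases hi : i = u
    · rw [hi, hσu]
      exact huj
    · rw [hσ i hi]
      exact (hφ' ⟨i, hi⟩).2

/-- One full row and otherwise rows of degree two give a simplex. -/
lemma suppFace_simplex (h : IsIndecomposable R) (hcard : Fintype.card I = Fintype.card J) {u : I}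
    (hu : ∀ j, R u j) (hd : ∀ v, v ≠ u → rowDeg R v = 2) :
    AffinelyEquivalent (suppFace R) (stdSimplex ℝ J) := by
  choose σ hσ hσu hσR using fun j => exists_bijective_of_hall h hcard (hu j)
  let M (j : J) : Matrix I J ℝ := fun i k => if σ j i = k then 1 else 0
  have hM : ∀ j, M j ∈ suppFace R := by
    intro j
    refine ⟨fun i k => ?_, fun i => ?_, fun k => ?_, fun i k hik => ?_⟩
    · simp only [M]
      split_ifs <;> norm_num
    · simp [M]
    · obtain ⟨i, rfl⟩ := (hσ j).2 k
      simp [M, (hσ j).1.eq_iff]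
    · refine if_neg ?_
      rintro rfl
      exact hik (hσR j i)
  have hg : ∀ a ∈ stdSimplex ℝ J, ∑ j, a j • M j ∈ suppFace R := fun a ha =>
    (convex_suppFace R).sum_mem (fun j _ => ha.1 j) ha.2 fun j _ => hM j
  have hgu : ∀ a : J → ℝ, (∑ j, a j • M j) u = a := by
    intro a
    ext k
    have hk : (∑ j, a j • M j) u k = ∑ j, a j * M j u k := by
      rw [Matrix.sum_apply]
      rfl
    rw [hk]
    simp [M, hσu]
  have hfu : ∀ x ∈ suppFace R, x u ∈ stdSimplex ℝ J := fun x hx => ⟨fun j => hx.1 u j, hx.2.1 u⟩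
  refine .of_invOn (convex_suppFace R) (fun x => x u) (fun a => ∑ j, a j • M j)
    (fun _ _ _ _ _ _ _ _ _ => rfl) hfu hg ?_ fun a _ => hgu a
  exact fun x hx => eq_of_row_eq h hd (hg _ (hfu x hx)) hx (hgu _)

end Components

section Pyramid

variable {I J : Type*} [Fintype J] {R : I → J → Prop}

lemma rel_iff_of_rowDeg {u v : I} (hu : rowDeg R u = 3) (hv : rowDeg R v = 2)
    (hvu : ∀ j, R v j → R u j) {w : J} (huw : R u w) (hvw : ¬ R v w) (j : J) :
    R u j ↔ j = w ∨ R v j := by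
  have hsub : insert w (Finset.univ.filter (R v)) ⊆ Finset.univ.filter (R u) := by
    intro j hj
    rcases Finset.mem_insert.1 hj with rfl | hj
    · simpa using huw
    · simpa using hvu j (by simpa using hj)
  have heq := Finset.eq_of_subset_of_card_le hsub (by
    rw [Finset.card_insert_of_notMem (by simpa using hvw)]
    change rowDeg R u ≤ rowDeg R v + 1
    omega)
  simpa using (congrArg (j ∈ ·) heq).symm

lemma exists_notMem_of_rowDeg {u v : I} (hu : rowDeg R u = 3) (hv : rowDeg R v = 2) :
    ∃ w, R u w ∧ ¬ R v w := by
  by_contra! h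
  have : rowDeg R u ≤ rowDeg R v :=
    Finset.card_le_card fun j hj => by simpa using h j (by simpa using hj)
  omega

variable [Fintype I]

/-- In a support which is tight in both directions the neighbourhoods of the rows of degree two
cover the columns. -/
lemma exists_rel_of_isTight (h : IsIndecomposable fun j i => R i j)
    (ht : IsTight fun j i => R i j) (hdeg : ∀ i, rowDeg R i = 2 ∨ rowDeg R i = 3)
    {v : {u // rowDeg R u = 3} → I} (hv : Function.Injective v)
    (hv₂ : ∀ i, rowDeg R i = 2 ↔ ∃ k, v k = i) (hvR : ∀ k j, R (v k) j → R k j) (w : J) :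
    ∃ k, R (v k) w := by
  by_contra! hcon
  obtain ⟨q, hqw, i₁, i₂, hi, h₁w, h₂w, h₁q, h₂q⟩ : ∃ q, q ≠ w ∧ ∃ i₁ i₂, i₁ ≠ i₂ ∧
      R i₁ w ∧ R i₂ w ∧ R i₁ q ∧ R i₂ q := by
    obtain ⟨hdeg', v', -, hv₂', hvR'⟩ := ht
    rcases hdeg' w with hw | hw
    · obtain ⟨q, hq, hq'⟩ := h.exists_partner hw
      obtain ⟨i₁, i₂, hi, hN⟩ := exists_of_rowDeg_eq_two hw
      have h₁ := (hN i₁).2 (.inl rfl)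
      have h₂ := (hN i₂).2 (.inr rfl)
      exact ⟨q, hq, i₁, i₂, hi, h₁, h₂, hq' _ h₁, hq' _ h₂⟩
    · have hq := (hv₂' (v' ⟨w, hw⟩)).2 ⟨_, rfl⟩
      obtain ⟨i₁, i₂, hi, hN⟩ := exists_of_rowDeg_eq_two hq
      have h₁ := (hN i₁).2 (.inl rfl)
      have h₂ := (hN i₂).2 (.inr rfl)
      refine ⟨v' ⟨w, hw⟩, fun hqw => ?_, i₁, i₂, hi, hvR' _ _ h₁, hvR' _ _ h₂, h₁, h₂⟩
      rw [hqw] at hq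
      omega
  have hthree : ∀ i, R i w → rowDeg R i = 3 := fun i hiw => (hdeg i).resolve_left fun h2 => by
    obtain ⟨k, rfl⟩ := (hv₂ i).1 h2
    exact hcon k hiw
  have hvq : ∀ i (hi : R i w), R i q → R (v ⟨i, hthree i hi⟩) q := fun i hi hiq =>
    ((rel_iff_of_rowDeg (hthree i hi) ((hv₂ _).2 ⟨_, rfl⟩) (hvR ⟨i, hthree i hi⟩) hi (hcon _)
      q).1 hiq).resolve_left hqw
  have hne : ∀ i (_ : R i w) k, i ≠ v k := by
    rintro i hi k rfl
    exact hcon k hi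
  have hsub : ({i₁, i₂, v ⟨i₁, hthree i₁ h₁w⟩, v ⟨i₂, hthree i₂ h₂w⟩} : Finset I) ⊆
      Finset.univ.filter fun i => R i q := by
    intro i
    have := hvq i₁ h₁w h₁q
    have := hvq i₂ h₂w h₂q
    simp only [Finset.mem_insert, Finset.mem_singleton, Finset.mem_filter, Finset.mem_univ,
      true_and]
    rintro (rfl | rfl | rfl | rfl) <;> assumption
  have hcard := Finset.card_le_card hsub
  have hvne : v ⟨i₁, hthree i₁ h₁w⟩ ≠ v ⟨i₂, hthree i₂ h₂w⟩ := fun heq =>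
    hi (congrArg Subtype.val (hv heq))
  rw [Finset.card_insert_of_notMem (by simp [hi, hne i₁ h₁w]),
    Finset.card_insert_of_notMem (by simp [hne i₂ h₂w]), Finset.card_pair hvne] at hcard
  have : rowDeg (fun j i => R i j) q ≤ 3 := by
    rcases ht.1 q with hq | hq <;> omega
  exact absurd (hcard.trans this) (by norm_num)

/-- A support which is tight in both directions gives a pyramid over a cube. -/
lemma suppFace_of_isTight (h : IsIndecomposable R) (h' : IsIndecomposable fun j i => R i j)
    (ht : IsTight R) (ht' : IsTight fun j i => R i j) (hcard : Fintype.card I = Fintype.card J) :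
    ∃ s, Fintype.card I = 2 * s ∧ AffinelyEquivalent (suppFace R) (cubePyramid s) := by
  obtain ⟨hdeg, v, hv, hv₂, hvR⟩ := ht
  have hcov := exists_rel_of_isTight h' ht' hdeg hv hv₂ hvR
  have hvd : ∀ k, rowDeg R (v k) = 2 := fun k => (hv₂ _).2 ⟨k, rfl⟩
  have hI : Function.Bijective (Sum.elim Subtype.val v : {u // rowDeg R u = 3} ⊕ _ → I) := by
    constructor
    · refine Subtype.val_injective.sumElim hv fun k l hkl => ?_
      have := hvd l
      rw [← hkl, k.2] at this
      omega
    · intro i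
      rcases hdeg i with hi | hi
      · obtain ⟨k, hk⟩ := (hv₂ i).1 hi
        exact ⟨.inr k, hk⟩
      · exact ⟨.inl ⟨i, hi⟩, rfl⟩
  let eI := Equiv.ofBijective _ hI
  have hs : Fintype.card I = 2 * Fintype.card {u // rowDeg R u = 3} := by
    rw [← Fintype.card_congr eI, Fintype.card_sum, two_mul]
  have hblocks : Function.Bijective
      (fun p => p.2.1 : (Σ k : {u // rowDeg R u = 3}, {j // R (v k) j}) → J) := by
    rw [Fintype.bijective_iff_surjective_and_card]
    refine ⟨fun w => ?_, ?_⟩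
    · obtain ⟨k, hk⟩ := hcov w
      exact ⟨⟨k, w, hk⟩, rfl⟩
    · rw [Fintype.card_sigma, ← hcard, hs, Finset.sum_congr rfl fun k _ =>
        (Fintype.card_subtype (R (v k))).trans (hvd k), Finset.sum_const, Finset.card_univ,
        smul_eq_mul, mul_comm]
  have huniq : ∀ k l w, R (v k) w → R (v l) w → k = l := fun k l w hk hl =>
    congrArg Sigma.fst (@hblocks.1 ⟨k, w, hk⟩ ⟨l, w, hl⟩ rfl)
  choose blk hblk using hcov
  have hblk' : ∀ k w, R (v k) w ↔ blk w = k := fun k w =>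
    ⟨fun hk => huniq _ _ _ (hblk w) hk, fun hk => hk ▸ hblk w⟩
  choose z hz hvz using fun k : {u // rowDeg R u = 3} => exists_notMem_of_rowDeg k.2 (hvd k)
  have hzR : ∀ k j, R k.1 j ↔ j = z k ∨ blk j = k := fun k j => by
    rw [rel_iff_of_rowDeg k.2 (hvd k) (hvR k) (hz k) (hvz k), hblk']
  let π₀ : {u // rowDeg R u = 3} → {u // rowDeg R u = 3} := fun k => blk (z k)
  have hπ₀ : ∀ k, π₀ k ≠ k := fun k hk => hvz k ((hblk' _ _).2 hk)
  have hbcard : ∀ k, (Finset.univ.filter fun w => blk w = k).card = 2 := fun k => by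
    rw [← hvd k, rowDeg]
    simp only [hblk']
  have htrans : ∀ A : Set {u // rowDeg R u = 3}, (∀ k ∈ A, π₀ k ∈ A) → A.Nonempty → A = univ := by
    intro A hA hne
    obtain ⟨hS, -⟩ := h.hall (A.toFinset.map ⟨_, Subtype.val_injective⟩ ∪ A.toFinset.map ⟨v, hv⟩)
      (Finset.univ.filter fun w => blk w ∈ A) (by
        obtain ⟨k, hk⟩ := hne
        exact ⟨k.1, Finset.mem_union_left _ (Finset.mem_map.2 ⟨k, by simpa using hk, rfl⟩)⟩) (by
        intro i hi j hj
        simp only [Finset.mem_filter, Finset.mem_univ, true_and]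
        rcases Finset.mem_union.1 hi with hi | hi
        · obtain ⟨k, hk, rfl⟩ := Finset.mem_map.1 hi
          rcases (hzR k j).1 hj with rfl | rfl
          · exact hA k (by simpa using hk)
          · simpa using hk
        · obtain ⟨k, hk, rfl⟩ := Finset.mem_map.1 hi
          rw [(hblk' k j).1 hj]
          simpa using hk) (by
        rw [Finset.card_union_of_disjoint, Finset.card_map, Finset.card_map,
          Finset.card_eq_sum_card_fiberwise (f := blk) (t := A.toFinset)]
        · calc ∑ k ∈ A.toFinset, _ ≤ ∑ k ∈ A.toFinset, 2 := by
                refine Finset.sum_le_sum fun k _ => ?_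
                rw [← hbcard k]
                exact Finset.card_le_card fun w hw =>
                  Finset.mem_filter.2 ⟨Finset.mem_univ _, (Finset.mem_filter.1 hw).2⟩
            _ = _ := by rw [Finset.sum_const, smul_eq_mul, mul_two]
        · intro w hw
          simpa using hw
        · rw [Finset.disjoint_left]
          rintro i hi hi'
          obtain ⟨k, -, rfl⟩ := Finset.mem_map.1 hi
          obtain ⟨l, -, hl⟩ := Finset.mem_map.1 hi'
          have := hvd l
          rw [show v l = k.1 from hl, k.2] at this
          omega)
    refine Set.eq_univ_of_forall fun k => ?_
    rcases Finset.mem_union.1 (hS ▸ Finset.mem_univ k.1) with hk | hk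
    · obtain ⟨l, hl, hlk⟩ := Finset.mem_map.1 hk
      rw [← Subtype.ext hlk]
      simpa using hl
    · obtain ⟨l, hl, hlk⟩ := Finset.mem_map.1 hk
      have := hvd l
      rw [show v l = k.1 from hlk, k.2] at this
      omega
  obtain ⟨k₀⟩ : Nonempty {u // rowDeg R u = 3} := by
    obtain ⟨i⟩ := h.nonempty
    rw [← Fintype.card_pos_iff]
    have := Fintype.card_pos_iff.2 ⟨i⟩
    omega
  have hsurj : Function.Surjective π₀ := range_eq_univ.1 <|
    htrans _ (fun k _ => mem_range_self k) ⟨_, mem_range_self k₀⟩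
  let π : Equiv.Perm {u // rowDeg R u = 3} :=
    Equiv.ofBijective π₀ (Finite.surjective_iff_bijective.1 hsurj)
  let a (k : {u // rowDeg R u = 3}) : J := z (π.symm k)
  have ha : ∀ k, blk (a k) = k := π.apply_symm_apply
  have hb : ∀ k, ∃ w, w ≠ a k ∧ ∀ j, blk j = k ↔ j = a k ∨ j = w := by
    intro k
    obtain ⟨w₁, w₂, hw, hN⟩ := exists_of_rowDeg_eq_two (hvd k)
    simp only [hblk'] at hN
    rcases (hN (a k)).1 (ha k) with hak | hak
    · exact ⟨w₂, hak ▸ hw.symm, by rwa [hak]⟩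
    · exact ⟨w₁, hak ▸ hw, fun j => by rw [hN, hak, or_comm]⟩
  choose b hba hb using hb
  have hbb : ∀ k, blk (b k) = k := fun k => (hb k _).2 (.inr rfl)
  have hza : ∀ k, z k = a (π k) := fun k => congrArg z (π.symm_apply_apply k).symm
  have hainj : Function.Injective a := fun k l hkl => by rw [← ha k, hkl, ha]
  have hJ : Function.Bijective (Sum.elim a b) := by
    constructor
    · refine hainj.sumElim (fun k l hkl => ?_) fun k l hkl => ?_
      · rw [← hbb k, hkl, hbb]
      · have : k = l := by rw [← ha k, hkl, hbb]
        exact hba l (this ▸ hkl.symm)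
    · intro j
      rcases (hb (blk j) j).1 rfl with hj | hj
      · exact ⟨.inl _, hj.symm⟩
      · exact ⟨.inr _, hj.symm⟩
  refine ⟨_, hs, .trans (.symm (suppFace_reindex _ eI (Equiv.ofBijective _ hJ) R ?_))
    (suppFace_chainRel π hπ₀ htrans k₀ rfl)⟩
  rintro (k | k) (l | l)
  · change (k = l ∨ l = π k) ↔ R k.1 (a l)
    rw [hzR, ha, hza, hainj.eq_iff, or_comm, eq_comm (a := l) (b := k)]
  · change k = l ↔ R k.1 (b l)
    rw [hzR, hbb, hza, eq_comm (a := l) (b := k)]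
    refine ⟨.inr, fun hkl => hkl.resolve_left fun hbl => ?_⟩
    have : l = π k := by rw [← hbb l, hbl, ha]
    exact hba l (by rw [hbl, ← this])
  · change k = l ↔ R (v k) (a l)
    rw [hblk', ha, eq_comm]
  · change k = l ↔ R (v k) (b l)
    rw [hblk', hbb, eq_comm]

end Pyramid

section Minimal

variable {I J : Type*} [Fintype I] [Fintype J] {R : I → J → Prop}

/-- No support with fewer rows has an affinely equivalent face. -/
def IsMinimalSupport (R : I → J → Prop) : Prop :=
  ∀ m < Fintype.card I, ∀ R' : Fin m → Fin m → Prop,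
    ¬ AffinelyEquivalent (suppFace R) (suppFace R')

namespace IsMinimalSupport

lemma le {I' J' : Type*} [Fintype I'] [Fintype J'] (h : IsMinimalSupport R)
    (R' : I' → J' → Prop) (hcard : Fintype.card I' = Fintype.card J')
    (hR' : AffinelyEquivalent (suppFace R) (suppFace R')) : Fintype.card I ≤ Fintype.card I' := by
  by_contra! hlt
  let e := Fintype.equivFin I'
  let e' := Fintype.equivFinOfCardEq hcard.symm
  exact h _ hlt (fun i j => R' (e.symm i) (e'.symm j))
    (hR'.trans (suppFace_reindex R' e e' _ (by simp)))

lemma of_affinelyEquivalent {I' J' : Type*} [Fintype I'] [Fintype J'] (h : IsMinimalSupport R)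
    {R' : I' → J' → Prop} (hcard : Fintype.card I' = Fintype.card I)
    (hR' : AffinelyEquivalent (suppFace R) (suppFace R')) : IsMinimalSupport R' :=
  fun m hm R'' hR'' => h m (hcard ▸ hm) R'' (hR'.trans hR'')

lemma transpose (h : IsMinimalSupport R) (hcard : Fintype.card I = Fintype.card J) :
    IsMinimalSupport fun j i => R i j :=
  h.of_affinelyEquivalent hcard.symm (suppFace_transpose R)

lemma irreducible (h : IsMinimalSupport R) (hcard : Fintype.card I = Fintype.card J) (v : I)
    (w₁ w₂ : J) (hw : w₁ ≠ w₂) (hv : ∀ j, R v j → j = w₁ ∨ j = w₂)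
    (h₁ : ¬ R v w₁ → ∀ u, u ≠ v → ¬ R u w₂) (h₂ : ¬ R v w₂ → ∀ u, u ≠ v → ¬ R u w₁) :
    ∃ u, u ≠ v ∧ R u w₁ ∧ R u w₂ := by
  by_contra! hu
  have hI := Fintype.card_pos_iff.2 ⟨v⟩
  have hc : Fintype.card {i // i ≠ v} = Fintype.card I - 1 := by
    rw [Fintype.card_subtype_compl, Fintype.card_subtype_eq]
  have hle := h.le _ (by
    have hJ := Fintype.one_lt_card_iff.2 ⟨w₁, w₂, hw⟩
    rw [hc, hcard]
    simp only [Fintype.card_option, Fintype.card_subtype_compl, Fintype.card_subtype_eq]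
    omega) (suppFace_contract hw hv hu h₁ h₂)
  omega

lemma two_le (h : IsMinimalSupport R) (hcard : Fintype.card I = Fintype.card J)
    (hI : 2 ≤ Fintype.card I) {x : Matrix I J ℝ} (hx : x ∈ suppFace R)
    (hpos : ∀ i j, R i j → 0 < x i j) (v : I) : 2 ≤ rowDeg R v := by
  by_contra! hlt
  have hv : ∀ w w', R v w → R v w' → w = w' := fun w w' hw hw' =>
    Finset.card_le_one.1 (Nat.le_of_lt_succ hlt) w (by simpa using hw) w' (by simpa using hw')
  obtain ⟨w, hw⟩ : ∃ w, R v w := by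
    by_contra! hcon
    have := hx.2.1 v
    rw [Finset.sum_eq_zero fun j _ => hx.2.2.2 v j (hcon j)] at this
    exact zero_ne_one this
  have hone : x v w = 1 := by
    rw [← hx.2.1 v]
    exact (Fintype.sum_eq_single w fun j hj => hx.2.2.2 v j fun hvj => hj (hv _ _ hvj hw)).symm
  have hcol : ∀ u, u ≠ v → ¬ R u w := fun u hu huw => by
    have hle := Finset.add_le_sum (f := fun i => x i w) (fun i _ => hx.1 i w)
      (Finset.mem_univ v) (Finset.mem_univ u) hu.symm
    rw [hx.2.2.1 w, hone] at hle
    linarith [hpos u w huw]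
  obtain ⟨w₂, hw₂⟩ := Fintype.exists_ne_of_one_lt_card (hcard ▸ hI : 1 < Fintype.card J) w
  obtain ⟨u, hu, huw, -⟩ := h.irreducible hcard v w w₂ hw₂.symm (fun j hj => .inl (hv _ _ hj hw))
    (fun hn => absurd hw hn) fun _ => hcol
  exact hcol u hu huw

end IsMinimalSupport

end Minimal

section Component

variable {I J C : Type*}

/-- The maps `p` and `q` send the rows and columns to their connected components. -/
structure IsComponentMap (p : I → C) (q : J → C) (R : I → J → Prop) : Prop where
  rel : ∀ i j, R i j → p i = q j
  surjective : Function.Surjective p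
  lift : ∀ (α : Type) (f : I → α) (g : J → α), (∀ i j, R i j → f i = g j) →
    ∃ φ : C → α, (∀ i, f i = φ (p i)) ∧ ∀ j, g j = φ (q j)

/-- The connected components of a support. -/
def Component (R : I → J → Prop) : Type _ :=
  Quot fun s t : I ⊕ J => ∃ i j, s = .inl i ∧ t = .inr j ∧ R i j

instance [Finite I] [Finite J] (R : I → J → Prop) : Finite (Component R) :=
  inferInstanceAs (Finite (Quot _))

lemma isComponentMap (R : I → J → Prop) (hR : ∀ j, ∃ i, R i j) :
    IsComponentMap (C := Component R) (fun i => Quot.mk _ (.inl i)) (fun j => Quot.mk _ (.inr j))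
      R := by
  have hrel : ∀ i j, R i j → (Quot.mk _ (.inl i) : Component R) = Quot.mk _ (.inr j) :=
    fun i j h => Quot.sound ⟨i, j, rfl, rfl, h⟩
  refine ⟨hrel, ?_, fun α f g hfg => ⟨Quot.lift (Sum.elim f g) ?_, fun _ => rfl, fun _ => rfl⟩⟩
  · rintro ⟨i | j⟩
    · exact ⟨i, rfl⟩
    · obtain ⟨i, hi⟩ := hR j
      exact ⟨i, hrel i j hi⟩
  · rintro - - ⟨i, j, rfl, rfl, h⟩
    exact hfg i j h

variable {R : I → J → Prop} {p : I → C} {q : J → C}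

lemma IsComponentMap.transpose (h : IsComponentMap p q R) (hR : ∀ i, ∃ j, R i j) :
    IsComponentMap q p fun j i => R i j where
  rel j i hij := (h.rel i j hij).symm
  surjective c := by
    obtain ⟨i, rfl⟩ := h.surjective c
    obtain ⟨j, hj⟩ := hR i
    exact ⟨j, (h.rel i j hj).symm⟩
  lift α f g hfg := by
    obtain ⟨φ, hφ, hφ'⟩ := h.lift α g f fun i j hij => (hfg j i hij).symm
    exact ⟨φ, hφ', hφ⟩

variable [Fintype J]

lemma rowDeg_fibreRel (hR : ∀ i j, R i j → p i = q j) {c : C} (i : {i // p i = c}) :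
    rowDeg (fibreRel p q R c) i = rowDeg R i := by
  rw [rowDeg, ← Finset.card_map (Function.Embedding.subtype _), rowDeg]
  congr 1
  ext j
  simp only [Finset.mem_map, Finset.mem_filter, Finset.mem_univ, true_and]
  refine ⟨?_, fun hj => ⟨⟨j, by rw [← hR i j hj, i.2]⟩, hj, rfl⟩⟩
  rintro ⟨j, hj, rfl⟩
  exact hj

variable [Fintype I]

lemma mem_iff_mem_of_card_le {x : Matrix I J ℝ} (hx : x ∈ suppFace R)
    (hpos : ∀ i j, R i j → 0 < x i j) {S : Finset I} {T : Finset J}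
    (hST : ∀ i ∈ S, ∀ j, R i j → j ∈ T) (hle : T.card ≤ S.card) {i : I} {j : J} (hij : R i j) :
    i ∈ S ↔ j ∈ T := by
  refine ⟨fun hi => hST i hi j hij, fun hj => ?_⟩
  by_contra hi
  have h₁ : ∑ j ∈ T, ∑ i ∈ S, x i j = S.card := by
    rw [Finset.sum_comm, Finset.sum_congr rfl fun i hi => ?_, Finset.sum_const, nsmul_one]
    rw [← hx.2.1 i]
    exact Finset.sum_subset (Finset.subset_univ _) fun j _ hj =>
      hx.2.2.2 i j fun h => hj (hST i hi j h)
  have h₂ : ∑ j ∈ T, ∑ i, x i j = T.card := by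
    simp [hx.2.2.1]
  have h₃ : ∑ j ∈ T, ∑ i ∈ S, x i j < ∑ j ∈ T, ∑ i, x i j :=
    Finset.sum_lt_sum (fun j _ => Finset.sum_le_univ_sum_of_nonneg fun i => hx.1 i j)
      ⟨j, hj, Finset.sum_lt_sum_of_subset (Finset.subset_univ _) (Finset.mem_univ i) hi
        (hpos i j hij) fun i _ _ => hx.1 i j⟩
  rw [h₁, h₂, Nat.cast_lt] at h₃
  omega

namespace IsComponentMap

lemma isIndecomposable (h : IsComponentMap p q R) {x : Matrix I J ℝ} (hx : x ∈ suppFace R)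
    (hpos : ∀ i j, R i j → 0 < x i j) (h₂ : ∀ i, 2 ≤ rowDeg R i)
    (hirr : ∀ v w₁ w₂, w₁ ≠ w₂ → (∀ j, R v j ↔ j = w₁ ∨ j = w₂) →
      ∃ u, u ≠ v ∧ R u w₁ ∧ R u w₂) (c : C) : IsIndecomposable (fibreRel p q R c) where
  nonempty := by
    obtain ⟨i, hi⟩ := h.surjective c
    exact ⟨i, hi⟩
  hall S T hS hST hle := by
    obtain ⟨φ, hφ, hφ'⟩ := h.lift Prop (fun i => ∃ hi, ⟨i, hi⟩ ∈ S) (fun j => ∃ hj, ⟨j, hj⟩ ∈ T)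
      fun i j hij => by
        have hc := h.rel i j hij
        refine propext ⟨fun ⟨hi, hiS⟩ => ⟨hc ▸ hi, hST _ hiS _ hij⟩, fun ⟨hj, hjT⟩ => ⟨hc ▸ hj, ?_⟩⟩
        exact (mem_iff_mem_of_card_le (fibre_mem_suppFace h.rel hx c) (fun i j => hpos i j) hST hle
          (i := ⟨i, hc ▸ hj⟩) (j := ⟨j, hj⟩) hij).2 hjT
    have hc : φ c := by
      obtain ⟨⟨i, hi⟩, hiS⟩ := hS
      rw [← hi, ← hφ]
      exact ⟨hi, hiS⟩
    refine ⟨Finset.eq_univ_of_forall fun ⟨i, hi⟩ => ?_, Finset.eq_univ_of_forall fun ⟨j, hj⟩ => ?_⟩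
    · exact ((hφ i).mpr (hi ▸ hc)).2
    · exact ((hφ' j).mpr (hj ▸ hc)).2
  two_le i := by
    rw [rowDeg_fibreRel h.rel]
    exact h₂ i
  irreducible v w₁ w₂ hw hv := by
    obtain ⟨u, hu, hu₁, hu₂⟩ := hirr v w₁ w₂ (fun h => hw (Subtype.ext h)) fun j => by
      refine ⟨fun hj => ?_, ?_⟩
      · have := (hv ⟨j, by rw [← h.rel _ _ hj, v.2]⟩).1 hj
        simpa [Subtype.ext_iff] using this
      · rintro (rfl | rfl)
        exacts [(hv w₁).2 (.inl rfl), (hv w₂).2 (.inr rfl)]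
    exact ⟨⟨u, by rw [h.rel _ _ hu₁, w₁.2]⟩, fun h => hu (congrArg Subtype.val h), hu₁, hu₂⟩

end IsComponentMap

end Component

section Dimension

variable {I J C : Type*} {R : I → J → Prop}

/-- The matrix supported on the entries of `R` with the given values. -/
noncomputable def extendEntries (R : I → J → Prop) :
    ({e : I × J // R e.1 e.2} → ℝ) →ₗ[ℝ] Matrix I J ℝ where
  toFun y := .of fun i j => if h : R i j then y ⟨(i, j), h⟩ else 0
  map_add' y z := by
    ext i j
    by_cases h : R i j <;> simp [h]
  map_smul' a y := by
    ext i j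
    by_cases h : R i j <;> simp [h]

lemma extendEntries_of_rel (y : {e : I × J // R e.1 e.2} → ℝ) {i : I} {j : J} (h : R i j) :
    extendEntries R y i j = y ⟨(i, j), h⟩ :=
  dif_pos h

lemma extendEntries_of_not_rel (y : {e : I × J // R e.1 e.2} → ℝ) {i : I} {j : J} (h : ¬ R i j) :
    extendEntries R y i j = 0 :=
  dif_neg h

lemma extendEntries_injective : Function.Injective (extendEntries R) := fun y z h => by
  ext ⟨⟨i, j⟩, hij⟩
  have := congrFun (congrFun h i) j
  rwa [extendEntries_of_rel y hij, extendEntries_of_rel z hij] at this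

/-- The incidence matrix of the bipartite graph of `R`. -/
noncomputable def incidence (R : I → J → Prop) : Matrix (I ⊕ J) {e : I × J // R e.1 e.2} ℝ
  | .inl i, e => if e.1.1 = i then 1 else 0
  | .inr j, e => if e.1.2 = j then 1 else 0

variable [Fintype I] [Fintype J]

lemma sum_entries (y : {e : I × J // R e.1 e.2} → ℝ) (f : I → J → ℝ) :
    ∑ e : {e : I × J // R e.1 e.2}, f e.1.1 e.1.2 * y e =
      ∑ i, ∑ j, f i j * extendEntries R y i j := by
  rw [← Fintype.sum_prod_type' fun i j => f i j * extendEntries R y i j,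
    ← Finset.sum_filter_of_ne (p := fun e : I × J => R e.1 e.2) fun e _ he => ?_]
  · rw [Finset.sum_subtype (p := fun e : I × J => R e.1 e.2) _ (by simp)]
    exact Finset.sum_congr rfl fun e _ => by rw [extendEntries_of_rel y e.2]
  · by_contra hR
    exact he (by rw [extendEntries_of_not_rel y hR, mul_zero])

lemma mem_ker_incidence (y : {e : I × J // R e.1 e.2} → ℝ) :
    y ∈ LinearMap.ker (incidence R).mulVecLin ↔
      (∀ i, ∑ j, extendEntries R y i j = 0) ∧ ∀ j, ∑ i, extendEntries R y i j = 0 := by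
  have hrow : ∀ i, (incidence R).mulVec y (.inl i) = ∑ j, extendEntries R y i j := fun i => by
    refine (sum_entries y fun i' _ => if i' = i then 1 else 0).trans ?_
    simp
  have hcol : ∀ j, (incidence R).mulVec y (.inr j) = ∑ i, extendEntries R y i j := fun j => by
    refine (sum_entries y fun _ j' => if j' = j then 1 else 0).trans ?_
    simp
  rw [LinearMap.mem_ker, Matrix.mulVecLin_apply, funext_iff, Sum.forall]
  simp only [hrow, hcol, Pi.zero_apply]

lemma vectorSpan_suppFace {x : Matrix I J ℝ} (hx : x ∈ suppFace R)
    (hpos : ∀ i j, R i j → 0 < x i j) :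
    vectorSpan ℝ (suppFace R) =
      (LinearMap.ker (incidence R).mulVecLin).map (extendEntries R) := by
  apply le_antisymm
  · refine Submodule.span_le.2 ?_
    rintro - ⟨a, ha, b, hb, rfl⟩
    have hext : extendEntries R (fun e => a e.1.1 e.1.2 - b e.1.1 e.1.2) = a - b := by
      ext i j
      by_cases h : R i j
      · rw [extendEntries_of_rel _ h]
        rfl
      · rw [extendEntries_of_not_rel _ h, Matrix.sub_apply, ha.2.2.2 i j h, hb.2.2.2 i j h,
          sub_zero]
    refine ⟨_, (mem_ker_incidence _).2 ⟨fun i => ?_, fun j => ?_⟩, hext⟩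
    · rw [hext]
      simp [ha.2.1, hb.2.1]
    · rw [hext]
      simp [ha.2.2.1, hb.2.2.1]
  · rintro - ⟨y, hy, rfl⟩
    obtain ⟨hrow, hcol⟩ := (mem_ker_incidence y).1 hy
    have hzero : ∀ i j, x i j = 0 → ¬ R i j := fun i j h hR => (hpos i j hR).ne' h
    obtain ⟨ε, hε, hle⟩ := exists_mul_abs_le hx.1 (extendEntries R y) fun i j h =>
      extendEntries_of_not_rel y (hzero i j h)
    have hmem : x + ε • extendEntries R y ∈ suppFace R := by
      refine ⟨fun i j => ?_, fun i => ?_, fun j => ?_, fun i j h => ?_⟩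
      · have h₁ := hle i j
        have h₂ := mul_le_mul_of_nonneg_left (neg_abs_le (extendEntries R y i j)) hε.le
        simp only [Matrix.add_apply, Matrix.smul_apply, smul_eq_mul]
        linarith
      · simp [Finset.sum_add_distrib, ← Finset.mul_sum, hx.2.1, hrow]
      · simp [Finset.sum_add_distrib, ← Finset.mul_sum, hx.2.2.1, hcol]
      · simp [hx.2.2.2 i j h, extendEntries_of_not_rel y h]
    have := Submodule.smul_mem _ ε⁻¹ (vsub_mem_vectorSpan ℝ hmem hx)
    rwa [vsub_eq_sub, add_sub_cancel_left, inv_smul_smul₀ hε.ne'] at this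

lemma card_entries : Fintype.card {e : I × J // R e.1 e.2} = ∑ i, rowDeg R i := by
  rw [Fintype.card_subtype, Finset.card_filter, Fintype.sum_prod_type]
  exact Finset.sum_congr rfl fun i _ => (Finset.card_filter _ _).symm

lemma finrank_ker_incidence_transpose [Fintype C] {p : I → C} {q : J → C}
    (h : IsComponentMap p q R) :
    Module.finrank ℝ (LinearMap.ker (incidence R).transpose.mulVecLin) = Fintype.card C := by
  have hker : ∀ f, f ∈ LinearMap.ker (incidence R).transpose.mulVecLin ↔
      ∀ i j, R i j → f (.inl i) + f (.inr j) = 0 := fun f => by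
    have : ∀ e, (incidence R).transpose.mulVec f e = f (.inl e.1.1) + f (.inr e.1.2) := fun e => by
      simp [Matrix.mulVec, dotProduct, Fintype.sum_sum_type, incidence]
    rw [LinearMap.mem_ker, Matrix.mulVecLin_apply, funext_iff, Subtype.forall, Prod.forall]
    simp only [this, Pi.zero_apply]
  let Φ : (C → ℝ) →ₗ[ℝ] I ⊕ J → ℝ :=
    { toFun := fun φ => Sum.elim (fun i => φ (p i)) fun j => -φ (q j)
      map_add' := fun φ ψ => by
        ext (i | j)
        · rfl
        · simp [add_comm]
      map_smul' := fun a φ => by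
        ext (i | j) <;> simp }
  have hΦ : LinearMap.range Φ = LinearMap.ker (incidence R).transpose.mulVecLin := by
    ext f
    rw [hker]
    constructor
    · rintro ⟨φ, rfl⟩ i j hij
      simp [Φ, h.rel i j hij]
    · intro hf
      obtain ⟨φ, hφ, hφ'⟩ := h.lift ℝ (fun i => f (.inl i)) (fun j => -f (.inr j)) fun i j hij =>
        eq_neg_of_add_eq_zero_left (hf i j hij)
      refine ⟨φ, ?_⟩
      ext (i | j)
      · exact (hφ i).symm
      · simp [Φ, ← hφ']
  rw [← hΦ, LinearMap.finrank_range_of_inj fun φ ψ h' => ?_, Module.finrank_fintype_fun_eq_card]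
  ext c
  obtain ⟨i, rfl⟩ := h.surjective c
  exact congrFun h' (.inl i)

/-- The dimension of a face in terms of the graph of its support. -/
lemma finrank_vectorSpan_suppFace [Fintype C] {p : I → C} {q : J → C} (h : IsComponentMap p q R)
    {x : Matrix I J ℝ} (hx : x ∈ suppFace R) (hpos : ∀ i j, R i j → 0 < x i j) :
    Module.finrank ℝ (vectorSpan ℝ (suppFace R)) + Fintype.card I + Fintype.card J =
      ∑ i, rowDeg R i + Fintype.card C := by
  have h₁ := LinearMap.finrank_range_add_finrank_ker (incidence R).mulVecLin
  have h₂ := LinearMap.finrank_range_add_finrank_ker (incidence R).transpose.mulVecLin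
  have h₃ := (incidence R).rank_transpose
  rw [Matrix.rank, Matrix.rank] at h₃
  rw [Module.finrank_fintype_fun_eq_card, card_entries] at h₁
  rw [Module.finrank_fintype_fun_eq_card, finrank_ker_incidence_transpose h, h₃,
    Fintype.card_sum] at h₂
  rw [vectorSpan_suppFace hx hpos,
    ← (Submodule.equivMapOfInjective _ extendEntries_injective _).finrank_eq]
  omega

end Dimension

section Classification

variable {I J C : Type*} [Fintype I] [Fintype J] {R : I → J → Prop} {p : I → C} {q : J → C}

lemma sum_rowDeg_transpose : ∑ j, rowDeg (fun j i => R i j) j = ∑ i, rowDeg R i :=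
  (Finset.sum_card_bipartiteAbove_eq_sum_card_bipartiteBelow R).symm

lemma affinelyEquivalent_segment (hI : Fintype.card I = 2) (hJ : Fintype.card J = 2)
    (hR : ∀ i j, R i j) : AffinelyEquivalent (suppFace R) (Icc (0 : ℝ) 1) :=
  (suppFace_reindex R (Fintype.equivFinOfCardEq hI) (Fintype.equivFinOfCardEq hJ) _
    (by simpa using hR)).trans suppFace_full_two

/-- The face of an indecomposable support with few entries. -/
lemma IsIndecomposable.classification (h : IsIndecomposable R)
    (h' : IsIndecomposable fun j i => R i j) (hcard : Fintype.card I = Fintype.card J)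
    (hno : Fintype.card I = 4 → ¬ AffinelyEquivalent (suppFace R) (stdSimplex ℝ (Fin 4))) :
    (Fintype.card I = 2 ∧ ∑ i, rowDeg R i = 4 ∧
      AffinelyEquivalent (suppFace R) (Icc (0 : ℝ) 1)) ∨
    (Fintype.card I = 3 ∧ ∑ i, rowDeg R i = 7 ∧
      AffinelyEquivalent (suppFace R) (stdSimplex ℝ (Fin 3))) ∨
    (5 * Fintype.card I ≤ 2 * ∑ i, rowDeg R i ∧
      (5 * Fintype.card I = 2 * ∑ i, rowDeg R i →
        ∃ s, Fintype.card I = 2 * s ∧ AffinelyEquivalent (suppFace R) (cubePyramid s))) := by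
  rcases h.trichotomy hcard with ⟨hI, he, hR⟩ | ⟨u, hu, hd, hI, he⟩ | ⟨hle, htight⟩
  · exact .inl ⟨hI, he, affinelyEquivalent_segment hI (hcard ▸ hI) hR⟩
  · right
    have hsimplex := suppFace_simplex h hcard hu hd
    rcases (by omega : Fintype.card I = 3 ∨ Fintype.card I = 4 ∨ 5 ≤ Fintype.card I) with
      h3 | h4 | h5
    · exact .inl ⟨h3, by omega, hsimplex.trans (stdSimplex_reindex (hcard ▸ h3))⟩
    · exact absurd (hsimplex.trans (stdSimplex_reindex (hcard ▸ h4))) (hno h4)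
    · exact .inr ⟨by omega, fun heq => by omega⟩
  · refine .inr (.inr ⟨hle, fun heq => ?_⟩)
    have he := sum_rowDeg_transpose (R := R)
    rcases h'.trichotomy hcard.symm with ⟨hJ, he', -⟩ | ⟨u, hu, hd, -, he'⟩ | ⟨-, htight'⟩
    · omega
    · have h4 : Fintype.card I = 4 := by omega
      exact absurd ((suppFace_transpose R).trans ((suppFace_simplex h' hcard.symm hu hd).trans
        (stdSimplex_reindex h4))) (hno h4)
    · exact suppFace_of_isTight h h' (htight heq) (htight' (by omega)) hcard

/-- A minimal support has no component whose face is a tetrahedron. -/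
lemma IsMinimalSupport.not_tetrahedron (h : IsMinimalSupport R)
    (hcard : Fintype.card I = Fintype.card J) (hR : ∀ i j, R i j → p i = q j) {c : C}
    (hI : Fintype.card {i // p i = c} = 4) (hJ : Fintype.card {j // q j = c} = 4) :
    ¬ AffinelyEquivalent (suppFace (fibreRel p q R c)) (stdSimplex ℝ (Fin 4)) := by
  intro haff
  let R' (i : {i // ¬ p i = c}) (j : {j // ¬ q j = c}) : Prop := R i j
  have h₁ : AffinelyEquivalent (suppFace R) (suppFace (sumRel (fibreRel p q R c) R')) := by
    refine .symm (suppFace_reindex _ (Equiv.sumCompl _) (Equiv.sumCompl _) R ?_)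
    rintro (i | i) (j | j)
    · rfl
    · exact iff_of_false id fun hij => j.2 ((hR _ _ hij).symm.trans i.2)
    · exact iff_of_false id fun hij => i.2 ((hR _ _ hij).trans j.2)
    · rfl
  have h₂ := h.le _ (by
    rw [Fintype.card_sum, Fintype.card_sum, Fintype.card_subtype_compl,
      Fintype.card_subtype_compl, hI, hJ, hcard]) (h₁.trans ((suppFace_sumRel _ _).trans
    ((haff.trans suppFace_tetrahedron.symm).prod (.refl (convex_suppFace R')) |>.trans
      (suppFace_sumRel _ _).symm)))
  have h₃ := Fintype.card_subtype_le fun i => p i = c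
  rw [Fintype.card_sum, Fintype.card_subtype_compl, hI, Fintype.card_fin] at h₂
  omega

lemma sum_eq_two {ι : Type*} [Fintype ι] {f : ι → ℕ} (h : ∑ i, f i = 2) :
    (∃ i, f i = 2 ∧ ∀ j, j ≠ i → f j = 0) ∨
      ∃ i j, j ≠ i ∧ f i = 1 ∧ f j = 1 ∧ ∀ k, k ≠ i → k ≠ j → f k = 0 := by
  obtain ⟨i, -, hi⟩ := Finset.exists_ne_zero_of_sum_ne_zero (h.trans_ne two_ne_zero)
  rw [← Finset.add_sum_erase _ _ (Finset.mem_univ i)] at h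
  by_cases hi2 : f i = 2
  · refine .inl ⟨i, hi2, fun j hj => ?_⟩
    exact Finset.sum_eq_zero_iff.1 (by omega : ∑ j ∈ Finset.univ.erase i, f j = 0) j (by simpa)
  · right
    have h1 : ∑ j ∈ Finset.univ.erase i, f j = 1 := by omega
    obtain ⟨j, hj, hj0⟩ := Finset.exists_ne_zero_of_sum_ne_zero (h1.trans_ne one_ne_zero)
    rw [← Finset.add_sum_erase _ _ hj] at h1
    refine ⟨i, j, Finset.ne_of_mem_erase hj, by omega, by omega, fun k hki hkj => ?_⟩
    exact Finset.sum_eq_zero_iff.1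
      (by omega : ∑ j ∈ (Finset.univ.erase i).erase j, f j = 0) k (by simp [hki, hkj])

/-- The face of a minimal support of maximal size. -/
lemma IsMinimalSupport.classification (h : IsMinimalSupport R) {x : Matrix I J ℝ}
    (hx : x ∈ suppFace R) (hpos : ∀ i j, R i j → 0 < x i j) {d : ℕ}
    (hd : Module.finrank ℝ (vectorSpan ℝ (suppFace R)) = d) (hI : Fintype.card I + 2 = 2 * d)
    (hI₂ : 2 ≤ Fintype.card I) :
    (∃ a s, s + a + 1 = d ∧
      AffinelyEquivalent (suppFace R) (cubePyramid s ×ˢ Icc (0 : Fin a → ℝ) 1)) ∨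
    ∃ a, d = a + 4 ∧ AffinelyEquivalent (suppFace R)
      (stdSimplex ℝ (Fin 3) ×ˢ stdSimplex ℝ (Fin 3) ×ˢ Icc (0 : Fin a → ℝ) 1) := by
  have hcard := card_eq_of_mem_suppFace hx
  have hx' := transpose_mem_suppFace hx
  have hpos' : ∀ j i, R i j → 0 < x.transpose j i := fun j i => hpos i j
  have h' := h.transpose hcard
  have h₂ := h.two_le hcard hI₂ hx hpos
  have h₂' := h'.two_le hcard.symm (hcard ▸ hI₂) hx' hpos'
  have hirr : ∀ v w₁ w₂, w₁ ≠ w₂ → (∀ j, R v j ↔ j = w₁ ∨ j = w₂) →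
      ∃ u, u ≠ v ∧ R u w₁ ∧ R u w₂ := fun v w₁ w₂ hw hv =>
    h.irreducible hcard v w₁ w₂ hw (fun j => (hv j).1) (fun hn => absurd ((hv _).2 (.inl rfl)) hn)
      fun hn => absurd ((hv _).2 (.inr rfl)) hn
  have hirr' : ∀ v w₁ w₂, w₁ ≠ w₂ → (∀ i, R i v ↔ i = w₁ ∨ i = w₂) →
      ∃ u, u ≠ v ∧ R w₁ u ∧ R w₂ u := fun v w₁ w₂ hw hv =>
    h'.irreducible hcard.symm v w₁ w₂ hw (fun j => (hv j).1)
      (fun hn => absurd ((hv _).2 (.inl rfl)) hn) fun hn => absurd ((hv _).2 (.inr rfl)) hn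
  have hcol : ∀ j, ∃ i, R i j := fun j => by
    obtain ⟨i, hi⟩ := Finset.card_pos.1 (two_pos.trans_le (h₂' j))
    exact ⟨i, (Finset.mem_filter.1 hi).2⟩
  have hrow : ∀ i, ∃ j, R i j := fun i => by
    obtain ⟨j, hj⟩ := Finset.card_pos.1 (two_pos.trans_le (h₂ i))
    exact ⟨j, (Finset.mem_filter.1 hj).2⟩
  have hcomp := isComponentMap R hcol
  set p : I → Component R := fun i => Quot.mk _ (.inl i)
  set q : J → Component R := fun j => Quot.mk _ (.inr j)
  have := Fintype.ofFinite (Component R)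
  have hdim := finrank_vectorSpan_suppFace hcomp hx hpos
  set n : Component R → ℕ := fun c => Fintype.card {i // p i = c}
  set e : Component R → ℕ := fun c => ∑ i, rowDeg (fibreRel p q R c) i with he
  have hn : ∑ c, n c = Fintype.card I := by
    rw [← Fintype.card_sigma, Fintype.card_congr (Equiv.sigmaFiberEquiv p)]
  have hne : ∑ c, e c = ∑ i, rowDeg R i := by
    simp only [he, rowDeg_fibreRel hcomp.rel]
    rw [← (Equiv.sigmaFiberEquiv p).sum_comp, Fintype.sum_sigma]
    rfl
  have hfcard : ∀ c, Fintype.card {i // p i = c} = Fintype.card {j // q j = c} := fun c =>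
    card_eq_of_mem_suppFace (fibre_mem_suppFace hcomp.rel hx c)
  have hcl := fun c => (hcomp.isIndecomposable hx hpos h₂ hirr c).classification
    ((hcomp.transpose hrow).isIndecomposable hx' hpos' h₂' hirr' c) (hfcard c)
    fun h4 => h.not_tetrahedron hcard hcomp.rel h4 (hfcard c ▸ h4)
  have hle : ∀ c, 5 * n c ≤ 2 * e c + 2 := fun c => by
    rcases hcl c with ⟨h₁, h₂, -⟩ | ⟨h₁, h₂, -⟩ | ⟨h₁, -⟩ <;> simp only [n, e] <;> omega
  have hsum : ∑ c, (2 * e c + 2 - 5 * n c) = 2 := by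
    have hadd : ∑ c, (2 * e c + 2 - 5 * n c) + ∑ c, 5 * n c = ∑ c, (2 * e c + 2) := by
      rw [← Finset.sum_add_distrib]
      exact Finset.sum_congr rfl fun c _ => Nat.sub_add_cancel (hle c)
    rw [Finset.sum_add_distrib, ← Finset.mul_sum, ← Finset.mul_sum, hn, hne, Finset.sum_const,
      Finset.card_univ, smul_eq_mul] at hadd
    omega
  have hzero : ∀ c, 2 * e c + 2 - 5 * n c = 0 → n c = 2 ∧
      AffinelyEquivalent (suppFace (fibreRel p q R c)) (Icc (0 : ℝ) 1) := fun c hc => by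
    rcases hcl c with ⟨h₁, -, h₂⟩ | ⟨h₁, h₂, -⟩ | ⟨h₁, -⟩
    · exact ⟨h₁, h₂⟩
    all_goals simp only [n, e] at hc; omega
  have hone : ∀ c, 2 * e c + 2 - 5 * n c = 1 → n c = 3 ∧
      AffinelyEquivalent (suppFace (fibreRel p q R c)) (stdSimplex ℝ (Fin 3)) := fun c hc => by
    rcases hcl c with ⟨h₁, h₂, -⟩ | ⟨h₁, -, h₂⟩ | ⟨h₁, -⟩
    · simp only [n, e] at hc; omega
    · exact ⟨h₁, h₂⟩
    · simp only [n, e] at hc; omega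
  have hpi := suppFace_pi hcomp.rel
  have hconv := fun c => convex_suppFace (fibreRel p q R c)
  rcases sum_eq_two hsum with ⟨c, hc, h0⟩ | ⟨c, c', hcc, hc, hc', h0⟩
  · left
    obtain ⟨s, hs, haff⟩ : ∃ s, n c = 2 * s ∧
        AffinelyEquivalent (suppFace (fibreRel p q R c)) (cubePyramid s) := by
      rcases hcl c with ⟨h₁, h₂, -⟩ | ⟨h₁, h₂, -⟩ | ⟨h₁, h₂⟩
      · simp only [n, e] at hc; omega
      · simp only [n, e] at hc; omega
      · exact h₂ (by simp only [n, e] at hc; omega)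
    have hcn : n c + 2 * Fintype.card {k // k ≠ c} = Fintype.card I := by
      rw [← hn, Fintype.sum_eq_add_sum_subtype_ne n c,
        Finset.sum_congr rfl fun k _ => (hzero k.1 (h0 _ k.2)).1, Finset.sum_const,
        Finset.card_univ, smul_eq_mul, mul_comm]
    exact ⟨_, s, by omega, hpi.trans ((AffinelyEquivalent.pi_split hconv c).trans
      (haff.prod (.pi_segment (fun k => (hzero k.1 (h0 _ k.2)).2) rfl)))⟩
  · right
    have hcn : n c + (n c' + 2 * Fintype.card {k : {k // k ≠ c} // k ≠ ⟨c', hcc⟩}) =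
        Fintype.card I := by
      rw [← hn, Fintype.sum_eq_add_sum_subtype_ne n c,
        Fintype.sum_eq_add_sum_subtype_ne (fun k : {k // k ≠ c} => n k) ⟨c', hcc⟩,
        Finset.sum_congr (g := fun _ => 2) rfl fun k _ =>
          (hzero k.1.1 (h0 _ k.1.2 fun hk => k.2 (Subtype.ext hk))).1, Finset.sum_const,
        Finset.card_univ, smul_eq_mul, mul_comm]
    have h3 := (hone c hc).1
    have h3' := (hone c' hc').1
    exact ⟨Fintype.card {k : {k // k ≠ c} // k ≠ ⟨c', hcc⟩}, by omega,
      hpi.trans ((AffinelyEquivalent.pi_split hconv c).trans ((hone c hc).2.prod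
      ((AffinelyEquivalent.pi_split (fun k : {k // k ≠ c} => hconv k) ⟨c', hcc⟩).trans
        ((hone c' hc').2.prod (.pi_segment
          (fun k => (hzero k.1.1 (h0 _ k.1.2 fun hk => k.2 (Subtype.ext hk))).2) rfl)))))⟩

end Classification

end BirkhoffFaces

/-- A `d`-dimensional combinatorial type (`d ≥ 3`) of Birkhoff face with Birkhoff
dimension `2d - 2` is a pyramid over a `(d-1)`-cube, a product of a cube with a
pyramid over a cube, or a product of two triangles with a cube. -/
theorem stmt17 (d : ℕ) (hd : 3 ≤ d)
    (F : Set (Matrix (Fin (2 * d - 2)) (Fin (2 * d - 2)) ℝ))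
    (hne : F.Nonempty) (hconv : Convex ℝ F)
    (hext : IsExtreme ℝ
      (doublyStochastic ℝ (Fin (2 * d - 2)) :
        Set (Matrix (Fin (2 * d - 2)) (Fin (2 * d - 2)) ℝ)) F)
    (hdim : Module.finrank ℝ ↥(vectorSpan ℝ F) = d)
    (hmin : ∀ m < 2 * d - 2, ∀ F' : Set (Matrix (Fin m) (Fin m) ℝ),
      Convex ℝ F' →
      IsExtreme ℝ (doublyStochastic ℝ (Fin m) : Set (Matrix (Fin m) (Fin m) ℝ)) F' →
      ¬ Nonempty (↥(facesOf F) ≃o ↥(facesOf F'))) :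
    Nonempty (↥(facesOf F) ≃o ↥(facesOf (cubePyramid (d - 1)))) ∨
    (∃ a b : ℕ, 1 ≤ a ∧ a + b + 1 = d ∧
      Nonempty (↥(facesOf F) ≃o
        ↥(facesOf ((Set.Icc (0 : Fin a → ℝ) 1) ×ˢ cubePyramid b)))) ∨
    (4 ≤ d ∧
      Nonempty (↥(facesOf F) ≃o
        ↥(facesOf ((stdSimplex ℝ (Fin 3)) ×ˢ (stdSimplex ℝ (Fin 3)) ×ˢ
          (Set.Icc (0 : Fin (d - 4) → ℝ) 1))))) := by
  obtain ⟨R, rfl, x, hx, hpos⟩ := exists_eq_suppFace hne hconv hext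
  have hR : IsMinimalSupport R := fun m hm R' hR' =>
    hmin m (Fintype.card_fin (2 * d - 2) ▸ hm) _ (convex_suppFace R') (isExtreme_suppFace R')
      hR'.facesOf_orderIso
  have hcard := Fintype.card_fin (2 * d - 2)
  rcases hR.classification hx hpos hdim (by omega) (by omega) with
    ⟨a, s, has, haff⟩ | ⟨a, rfl, haff⟩
  · have hP : Convex ℝ (cubePyramid s) := convex_convexHull ℝ _
    rcases Nat.eq_zero_or_pos a with rfl | ha
    · left
      obtain rfl : s = d - 1 := by omega
      have hcube : Set.Icc (0 : Fin 0 → ℝ) 1 = {0} :=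
        Set.eq_singleton_iff_unique_mem.2 ⟨by simp, fun _ _ => Subsingleton.elim _ _⟩
      rw [hcube] at haff
      exact (haff.trans (.prod_unique hP 0)).facesOf_orderIso
    · exact .inr (.inl ⟨a, s, ha, by omega,
        (haff.trans (.prodComm hP (convex_Icc 0 1))).facesOf_orderIso⟩)
  · exact .inr (.inr ⟨by omega, haff.facesOf_orderIso⟩)
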